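/- arXiv:1906.03668 — 8 statements merged into one kernel-verified Lean document; each statement's English description precedes it below -/
import Mathlib

section
/- Let n ≥ 1 be an integer and ε > 0. Then there exists a ∈ (0,1) such that, setting F_a(x) = 1 + a·cos(n·x) and Q_a(x) = 1 + a·n²·cos(n·x)/(1 + a·cos(n·x)), one has: Q_a(x) > 0 and |Q_a(x) − 1| < ε for all x ∈ ℝ; the (real analytic) function Φ_a(x,y) = F_a(x)·cos(y) satisfies ∂²Φ_a/∂x² + ∂²Φ_a/∂y² + Q_a(x)·Φ_a = 0 on ℝ²; and the set {(x,y) ∈ (−π,π] × (−π,π) | Φ_a(x,y) > 1} has at least n connected components. -/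
open Real

/-- Near every point where `cos` is positive there is a multiple of `2π` within `π / 2`. -/
lemma abs_sub_round_lt_of_cos_pos {u : ℝ} (hu : 0 < cos u) :
    |u - 2 * π * round (u / (2 * π))| < π / 2 := by
  have hπ := pi_pos
  have hr := abs_sub_round (u / (2 * π))
  set k := round (u / (2 * π))
  have hle : |u - 2 * π * k| ≤ π := by
    have h : u - 2 * π * k = 2 * π * (u / (2 * π) - k) := by field_simp
    rw [h, abs_mul, abs_of_pos (by positivity)]
    nlinarith
  by_contra! hge
  have hcos : cos |u - 2 * π * k| = cos u := by
    rw [cos_abs, mul_comm, cos_sub_int_mul_two_pi]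
  have := cos_nonpos_of_pi_div_two_le_of_le hge (by linarith)
  linarith

lemma round_eq_of_abs_sub_lt {u : ℝ} {k : ℤ} (h : |u - 2 * π * k| < π / 2) :
    round (u / (2 * π)) = k := by
  have hπ := pi_pos
  obtain ⟨h1, h2⟩ := abs_lt.1 h
  rw [round_eq, Int.floor_eq_iff]
  constructor
  · have : (k : ℝ) - 1 / 2 ≤ u / (2 * π) := by
      rw [le_div_iff₀ (by positivity)]; nlinarith
    linarith
  · have : u / (2 * π) < k + 1 / 2 := by
      rw [div_lt_iff₀ (by positivity)]; nlinarith
    linarith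

/-- The part of the superlevel set lying over the `k`-th bump of `cos (n x)` is convex. -/
lemma convex_superlevel_bump (n : ℕ) {a : ℝ} (ha : 0 < a) (k : ℤ) :
    Convex ℝ {p : ℝ × ℝ | p.1 ∈ Set.Ioc (-π) π ∧ |n * p.1 - 2 * π * k| < π / 2 ∧
      |p.2| < π / 2 ∧ 1 < (1 + a * cos (n * p.1)) * cos p.2} := by
  rintro ⟨x, y⟩ ⟨hx, hnx, hy, h⟩ ⟨x', y'⟩ ⟨hx', hnx', hy', h'⟩ s t hs ht hst
  simp only [abs_lt] at hnx hy hnx' hy' h h'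
  have hc : ConcaveOn ℝ (Set.Icc (-(π / 2)) (π / 2)) cos := strictConcaveOn_cos_Icc.concaveOn
  have hshift : ∀ z : ℝ, cos (n * z - 2 * π * k) = cos (n * z) := fun z ↦ by
    rw [mul_comm (2 * π), cos_sub_int_mul_two_pi]
  have hIoo := convex_Ioo (𝕜 := ℝ) (-(π / 2)) (π / 2)
  have e : s • (n * x - 2 * π * k) + t • (n * x' - 2 * π * k)
      = n * (s * x + t * x') - 2 * π * k := by
    simp only [smul_eq_mul]; linear_combination (-2 * π * k) * hst
  have m1 := hIoo hnx hnx' hs ht hst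
  rw [e] at m1
  have m2 := hIoo hy hy' hs ht hst
  have c1 := hc.2 (Set.Ioo_subset_Icc_self hnx) (Set.Ioo_subset_Icc_self hnx') hs ht hst
  rw [e, hshift, hshift, hshift] at c1
  have c2 := hc.2 (Set.Ioo_subset_Icc_self hy) (Set.Ioo_subset_Icc_self hy') hs ht hst
  simp only [smul_eq_mul] at c1 c2 m1 m2
  refine ⟨convex_Ioc (𝕜 := ℝ) _ _ hx hx' hs ht hst, ?_, ?_, ?_⟩
  · simpa [abs_lt] using m1
  · simpa [abs_lt] using m2
  · simp only [Prod.smul_mk, Prod.mk_add_mk, smul_eq_mul]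
    have p1 := cos_pos_of_mem_Ioo hnx
    have p2 := cos_pos_of_mem_Ioo hnx'
    rw [hshift] at p1 p2
    have q1 := cos_pos_of_mem_Ioo hy
    have q2 := cos_pos_of_mem_Ioo hy'
    set F := 1 + a * cos (n * x) with hF
    set F' := 1 + a * cos (n * x') with hF'
    have f1 : 0 < F := by positivity
    have f2 : 0 < F' := by positivity
    have key : s * F + t * F' ≤ 1 + a * cos (n * (s * x + t * x')) := by
      rw [hF, hF']; nlinarith
    have cross : 2 < F * cos y' + F' * cos y := by
      have hprod : 1 < (F * cos y') * (F' * cos y) := by nlinarith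
      have : 0 < F * cos y' := by positivity
      have : 0 < F' * cos y := by positivity
      nlinarith [sq_nonneg (F * cos y' - F' * cos y)]
    have main : 1 < (s * F + t * F') * (s * cos y + t * cos y') := by
      have : (s * F + t * F') * (s * cos y + t * cos y') - 1 = s ^ 2 * (F * cos y - 1)
          + t ^ 2 * (F' * cos y' - 1) + s * t * (F * cos y' + F' * cos y - 2) := by
        linear_combination (s + t + 1) * hst
      rcases hs.eq_or_lt with rfl | hs
      · obtain rfl : t = 1 := by linarith
        linarith
      · have : 0 < s ^ 2 * (F * cos y - 1) := mul_pos (by positivity) (by linarith)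
        have : 0 ≤ t ^ 2 * (F' * cos y' - 1) := mul_nonneg (by positivity) (by linarith)
        have : 0 ≤ s * t * (F * cos y' + F' * cos y - 2) :=
          mul_nonneg (by positivity) (by linarith)
        linarith
    refine main.trans_le (mul_le_mul key c2 (by positivity) ?_)
    exact le_trans (by positivity) key

/-- The components are finite in number (as `Nat.card` requires) since each bump of `cos (n x)`
over `(-π, π]` carries at most one of them. -/
lemma card_connectedComponents_superlevel (n : ℕ) (hn : 1 ≤ n) {a : ℝ} (ha : 0 < a)
    (ha1 : a < 1) :
    n ≤ Nat.card (ConnectedComponents {p : ℝ × ℝ // p.1 ∈ Set.Ioc (-π) π ∧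
      p.2 ∈ Set.Ioo (-π) π ∧ 1 < (1 + a * cos (n * p.1)) * cos p.2}) := by
  have hπ := pi_pos
  have hn' : (1 : ℝ) ≤ n := by exact_mod_cast hn
  set S := {p : ℝ × ℝ // p.1 ∈ Set.Ioc (-π) π ∧
      p.2 ∈ Set.Ioo (-π) π ∧ 1 < (1 + a * cos (n * p.1)) * cos p.2}
  let label : S → ℤ := fun p ↦ round (n * p.1.1 / (2 * π))
  have hpos : ∀ p : S, 0 < cos (n * p.1.1) ∧ |p.1.2| < π / 2 := by
    rintro ⟨⟨x, y⟩, hx, hy, h⟩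
    have hF : 0 < 1 + a * cos (n * x) := by nlinarith [neg_one_le_cos (n * x)]
    have hy0 : 0 < cos y := by
      by_contra! hle
      have := mul_nonpos_of_nonneg_of_nonpos hF.le hle
      simp only at h
      linarith
    constructor
    · have := mul_le_of_le_one_right hF.le (cos_le_one y)
      simp only at h
      exact pos_of_mul_pos_right (by linarith : 0 < a * cos (n * x)) ha.le
    · by_contra! hge
      have := cos_nonpos_of_pi_div_two_le_of_le hge
        (by linarith [abs_lt.2 (show -π < y ∧ y < π from hy)])
      rw [cos_abs] at this
      exact this.not_gt hy0
  have hlabel : ∀ p : S, |n * p.1.1 - 2 * π * label p| < π / 2 := fun p ↦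
    abs_sub_round_lt_of_cos_pos (hpos p).1
  have hcont : Continuous label := by
    refine IsLocallyConstant.continuous ((IsLocallyConstant.iff_exists_open _).2 fun p ↦
      ⟨{q | |n * q.1.1 - 2 * π * label p| < π / 2}, ?_, hlabel p,
        fun q hq ↦ round_eq_of_abs_sub_lt hq⟩)
    exact isOpen_lt (by fun_prop) continuous_const
  have hinj : Function.Injective hcont.connectedComponentsLift := by
    intro c d hcd
    obtain ⟨p, rfl⟩ := ConnectedComponents.surjective_coe c
    obtain ⟨q, rfl⟩ := ConnectedComponents.surjective_coe d
    simp only [Continuous.connectedComponentsLift_apply_coe] at hcd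
    rw [ConnectedComponents.coe_eq_coe']
    have hpre : IsPreconnected ((↑) ⁻¹' {p : ℝ × ℝ | p.1 ∈ Set.Ioc (-π) π ∧
        |n * p.1 - 2 * π * label q| < π / 2 ∧
        |p.2| < π / 2 ∧ 1 < (1 + a * cos (n * p.1)) * cos p.2} : Set S) := by
      have hind : Topology.IsInducing (Subtype.val : S → ℝ × ℝ) := ⟨rfl⟩
      rw [← hind.isPreconnected_image, Set.image_preimage_eq_of_subset]
      · exact (convex_superlevel_bump n ha (label q)).isPreconnected
      · rintro r ⟨h1, -, h3, h4⟩
        exact ⟨⟨r, h1, abs_lt.1 (h3.trans (by linarith)), h4⟩, rfl⟩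
    exact hpre.subset_connectedComponent ⟨q.2.1, hlabel q, (hpos q).2, q.2.2.2⟩
      ⟨p.2.1, hcd ▸ hlabel p, (hpos p).2, p.2.2.2⟩
  have hfin : Finite (ConnectedComponents S) := by
    have hmem : ∀ c, hcont.connectedComponentsLift c ∈ Set.Icc (-n : ℤ) n := by
      intro c
      obtain ⟨p, rfl⟩ := ConnectedComponents.surjective_coe c
      simp only [Continuous.connectedComponentsLift_apply_coe]
      obtain ⟨h1, h2⟩ := abs_lt.1 (hlabel p)
      obtain ⟨h3, h4⟩ := p.2.1
      constructor
      · have : (-n : ℝ) ≤ label p := by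
          by_contra! hlt
          nlinarith
        exact_mod_cast this
      · have : (label p : ℝ) ≤ n := by
          by_contra! hlt
          nlinarith
        exact_mod_cast this
    exact Finite.of_injective (Set.codRestrict _ _ hmem) (hinj.codRestrict hmem)
  let idx : Fin n → ℤ := fun j ↦ (j : ℤ) - ((n - 1) / 2 : ℕ)
  have hpt : ∀ j : Fin n, ∃ p : S, label p = idx j := by
    intro j
    have hj := j.2
    have l1 : -(n : ℤ) < 2 * idx j := by simp only [idx]; omega
    have l2 : 2 * idx j ≤ (n : ℤ) := by simp only [idx]; omega
    have l1' : -(n : ℝ) < 2 * idx j := by exact_mod_cast l1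
    have l2' : 2 * (idx j : ℝ) ≤ n := by exact_mod_cast l2
    have e : n * (2 * π * idx j / n) = 2 * π * (idx j : ℝ) := by field_simp
    have hcos : cos (n * (2 * π * idx j / n)) = 1 := by
      rw [e, mul_comm, cos_int_mul_two_pi]
    refine ⟨⟨(2 * π * idx j / n, 0), ⟨?_, ?_⟩, ⟨by simpa, by simpa⟩, ?_⟩, ?_⟩
    · rw [lt_div_iff₀ (by positivity)]; nlinarith
    · rw [div_le_iff₀ (by positivity)]; nlinarith
    · simp only [hcos, cos_zero]; linarith
    · refine round_eq_of_abs_sub_lt ?_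
      rw [e, sub_self, abs_zero]; positivity
  choose pt hpt using hpt
  have := Nat.card_le_card_of_injective (fun j ↦ (pt j : ConnectedComponents S)) fun i j hij ↦ by
    have h := congrArg hcont.connectedComponentsLift hij
    simp only [Continuous.connectedComponentsLift_apply_coe, hpt] at h
    ext
    simp only [idx] at h
    omega
  simpa using this

/-- For every `n ≥ 1` and `ε > 0` there is `a ∈ (0,1)` such that, with
`F_a(x) = 1 + a·cos(nx)`, `Q_a(x) = 1 + a n² cos(nx)/(1 + a cos(nx))` and
`Φ_a(x,y) = F_a(x)cos(y)`: `Q_a > 0` and `|Q_a − 1| < ε`; `Φ_a` satisfies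
`∂²Φ_a/∂x² + ∂²Φ_a/∂y² + Q_a Φ_a = 0`; and `{(x,y) ∈ (−π,π] × (−π,π) | Φ_a(x,y) > 1}`
has at least `n` connected components. -/
theorem analytic_liouville_metric_superlevel_components
    (n : ℕ) (hn : 1 ≤ n) (ε : ℝ) (hε : 0 < ε) :
    ∃ a : ℝ, a ∈ Set.Ioo (0 : ℝ) 1 ∧
    ∃ (Fa Qa : ℝ → ℝ) (Φa : ℝ → ℝ → ℝ),
      (∀ x, Fa x = 1 + a * Real.cos (n * x)) ∧
      (∀ x, Qa x = 1 + a * (n : ℝ) ^ 2 * Real.cos (n * x) / (1 + a * Real.cos (n * x))) ∧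
      (∀ x y, Φa x y = Fa x * Real.cos y) ∧
      (∀ x, 0 < Qa x ∧ |Qa x - 1| < ε) ∧
      (∀ x y, deriv (deriv (fun t => Φa t y)) x + deriv (deriv (fun t => Φa x t)) y +
        Qa x * Φa x y = 0) ∧
      n ≤ Nat.card (ConnectedComponents
        {p : ℝ × ℝ // p.1 ∈ Set.Ioc (-π) π ∧ p.2 ∈ Set.Ioo (-π) π ∧ 1 < Φa p.1 p.2}) := by
  have hn' : (1 : ℝ) ≤ n := by exact_mod_cast hn
  have hn2 : (1 : ℝ) ≤ (n : ℝ) ^ 2 := one_le_pow₀ hn'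
  have hδ : 0 < min 1 ε := lt_min one_pos hε
  obtain ⟨a, ha, han⟩ : ∃ a : ℝ, 0 < a ∧ a * (n : ℝ) ^ 2 = min 1 ε / 4 :=
    ⟨min 1 ε / 4 / (n : ℝ) ^ 2, by positivity, by field_simp⟩
  have ha4 : a ≤ 1 / 4 := by nlinarith [min_le_left 1 ε]
  have hF : ∀ x : ℝ, 3 / 4 ≤ 1 + a * cos (n * x) := fun x ↦ by
    nlinarith [neg_one_le_cos (n * x)]
  refine ⟨a, ⟨ha, by linarith⟩, fun x ↦ 1 + a * cos (n * x),
    fun x ↦ 1 + a * (n : ℝ) ^ 2 * cos (n * x) / (1 + a * cos (n * x)),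
    fun x y ↦ (1 + a * cos (n * x)) * cos y, fun _ ↦ rfl, fun _ ↦ rfl, fun _ _ ↦ rfl,
    fun x ↦ ?_, fun x y ↦ ?_, card_connectedComponents_superlevel n hn ha (by linarith)⟩
  · have hlt : |a * (n : ℝ) ^ 2 * cos (n * x) / (1 + a * cos (n * x))| < min 1 ε := by
      have hx := hF x
      rw [abs_div, abs_of_pos (show 0 < 1 + a * cos (n * x) by linarith),
        div_lt_iff₀ (by linarith), abs_mul, han, abs_of_pos (by positivity)]
      nlinarith [abs_cos_le_one (n * x)]
    constructor
    · linarith [(abs_lt.1 (hlt.trans_le (min_le_left _ _))).1]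
    · simpa using hlt.trans_le (min_le_right _ _)
  · have d1 : deriv (fun t ↦ (1 + a * cos (n * t)) * cos y)
        = fun t ↦ -(a * n) * sin (n * t) * cos y := by
      funext t
      have h : HasDerivAt (fun t : ℝ ↦ (n : ℝ) * t) n t := by
        simpa using (hasDerivAt_id t).const_mul (n : ℝ)
      convert (((h.cos.const_mul a).const_add 1).mul_const (cos y)).deriv using 1
      ring
    have d2 : deriv (fun t ↦ -(a * n) * sin (n * t) * cos y) x
        = -(a * n ^ 2 * cos (n * x)) * cos y := by
      have h : HasDerivAt (fun t : ℝ ↦ (n : ℝ) * t) n x := by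
        simpa using (hasDerivAt_id x).const_mul (n : ℝ)
      convert ((h.sin.const_mul (-(a * n))).mul_const (cos y)).deriv using 1
      ring
    have d3 : deriv (fun t ↦ (1 + a * cos (n * x)) * cos t)
        = fun t ↦ (1 + a * cos (n * x)) * -sin t := by
      funext t
      exact ((hasDerivAt_cos t).const_mul _).deriv
    have d4 : deriv (fun t ↦ (1 + a * cos (n * x)) * -sin t) y
        = (1 + a * cos (n * x)) * -cos y :=
      ((hasDerivAt_sin y).neg.const_mul _).deriv
    rw [d1, d2, d3, d4]
    have := hF x
    have hne : 1 + a * cos (n * x) ≠ 0 := by linarith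
    field_simp
    ring
end

section
/- Let n ≥ 3 be an integer and define p : ℝ → ℝ by p(x) = (n/2)·(cos((n+1)x)/(n+2) + cos((n−1)x)/(n−2)). Then p is even, p''(x) + p(x) + n²·cos(n·x)·cos(x) = 0 for all x ∈ ℝ, and ∫_{−π}^{π} p(x)·cos(x) dx = 0. (Thus p is the unique even solution orthogonal to cos of the first-order perturbation equation −u₁'' = u₁ + n² cos(nx) cos(x).) -/
open Real

theorem hasDerivAt_cos_const_mul (a x : ℝ) :
    HasDerivAt (fun y => Real.cos (a * y)) (-a * Real.sin (a * x)) x :=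
  ((hasDerivAt_id' x).const_mul a).cos.congr_deriv (by ring)

theorem hasDerivAt_sin_const_mul (a x : ℝ) :
    HasDerivAt (fun y => Real.sin (a * y)) (a * Real.cos (a * x)) x :=
  ((hasDerivAt_id' x).const_mul a).sin.congr_deriv (by ring)

/-- Cosines of integer frequency `m` with `m ^ 2 ≠ 1` are orthogonal to `cos` on `[-π, π]`. -/
theorem integral_cos_int_mul_mul_cos (m : ℤ) (hm : (m : ℝ) ^ 2 - 1 ≠ 0) :
    ∫ x in (-π)..π, Real.cos (m * x) * Real.cos x = 0 := by
  have hderiv : ∀ x ∈ Set.uIcc (-π) π, HasDerivAt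
      (fun y => ((m * Real.sin (m * y)) * Real.cos y - Real.cos (m * y) * Real.sin y) /
        ((m : ℝ) ^ 2 - 1)) (Real.cos (m * x) * Real.cos x) x := by
    intro x _
    refine HasDerivAt.congr_deriv (((((hasDerivAt_sin_const_mul m x).const_mul (m : ℝ)).mul
      (Real.hasDerivAt_cos x)).sub
      ((hasDerivAt_cos_const_mul m x).mul (Real.hasDerivAt_sin x))).div_const _) ?_
    rw [div_eq_iff hm]
    ring
  rw [intervalIntegral.integral_eq_sub_of_hasDerivAt hderiv
    (Continuous.intervalIntegrable (by fun_prop) _ _)]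
  simp [Real.sin_int_mul_pi]

/-- For `n ≥ 3`, the function
`p(x) = (n/2)(cos((n+1)x)/(n+2) + cos((n−1)x)/(n−2))` is even, solves
`p'' + p + n²cos(nx)cos(x) = 0`, and is orthogonal to `cos` on `[−π,π]`. -/
theorem first_order_perturbation_even
    (n : ℕ) (hn : 3 ≤ n) (p : ℝ → ℝ)
    (hp : ∀ x, p x = ((n : ℝ) / 2) *
      (Real.cos (((n : ℝ) + 1) * x) / ((n : ℝ) + 2) +
        Real.cos (((n : ℝ) - 1) * x) / ((n : ℝ) - 2))) :
    (∀ x, p (-x) = p x) ∧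
    (∀ x, deriv (deriv p) x + p x + (n : ℝ) ^ 2 * Real.cos (n * x) * Real.cos x = 0) ∧
    (∫ x in (-π)..π, p x * Real.cos x) = 0 := by
  have hn' : (3 : ℝ) ≤ n := by exact_mod_cast hn
  have h₁ : (n : ℝ) + 2 ≠ 0 := by linarith
  have h₂ : (n : ℝ) - 2 ≠ 0 := by linarith
  obtain rfl : p = _ := funext hp
  refine ⟨fun x => by simp only [mul_neg, Real.cos_neg], fun x => ?_, ?_⟩
  · have hd := deriv_eq fun y => (((hasDerivAt_cos_const_mul ((n : ℝ) + 1) y).div_const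
      ((n : ℝ) + 2)).add ((hasDerivAt_cos_const_mul ((n : ℝ) - 1) y).div_const
      ((n : ℝ) - 2))).const_mul ((n : ℝ) / 2)
    have hdd := (((((hasDerivAt_sin_const_mul ((n : ℝ) + 1) x).const_mul (-((n : ℝ) + 1))).div_const
      ((n : ℝ) + 2)).add (((hasDerivAt_sin_const_mul ((n : ℝ) - 1) x).const_mul
      (-((n : ℝ) - 1))).div_const ((n : ℝ) - 2))).const_mul ((n : ℝ) / 2)).deriv
    simp only [Pi.add_def] at hd hdd
    rw [hd, hdd]
    simp only [add_mul (n : ℝ) 1 x, sub_mul (n : ℝ) 1 x, one_mul, Real.cos_add, Real.cos_sub]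
    field_simp
    ring
  · have hplus := integral_cos_int_mul_mul_cos (n + 1) (by push_cast; nlinarith)
    have hminus := integral_cos_int_mul_mul_cos (n - 1) (by push_cast; nlinarith)
    push_cast at hplus hminus
    have hsplit : ∀ x : ℝ, ((n : ℝ) / 2) * (Real.cos (((n : ℝ) + 1) * x) / ((n : ℝ) + 2) +
        Real.cos (((n : ℝ) - 1) * x) / ((n : ℝ) - 2)) * Real.cos x =
        (n : ℝ) / 2 / ((n : ℝ) + 2) * (Real.cos (((n : ℝ) + 1) * x) * Real.cos x) +
        (n : ℝ) / 2 / ((n : ℝ) - 2) * (Real.cos (((n : ℝ) - 1) * x) * Real.cos x) :=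
      fun x => by ring
    simp only [hsplit]
    rw [intervalIntegral.integral_add (Continuous.intervalIntegrable (by fun_prop) _ _)
      (Continuous.intervalIntegrable (by fun_prop) _ _), intervalIntegral.integral_const_mul,
      intervalIntegral.integral_const_mul, hplus, hminus]
    simp
end

section
/- Let n ≥ 3 be an integer and let p(x) = (n/2)·(cos((n+1)x)/(n+2) + cos((n−1)x)/(n−2)). Then ∫_{−π}^{π} cos²(n·x)·cos²(x) dx − ∫_{−π}^{π} cos(n·x)·p(x)·cos(x) dx = −2π/(n² − 4), which is strictly negative. (Equivalently, ∫_{−π}^{π} cos²(nx)cos²(x) dx = π/2 and ∫_{−π}^{π} cos(nx)p(x)cos(x) dx = (π/2)·n²/(n²−4); this shows that the second-order coefficient σ₂ in the perturbation expansion of the eigenvalue σ(a) is negative, so σ(a) < 1 for small a.) -/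
open Real

/-- A nontrivial integer-frequency cosine has zero mean over a period. -/
theorem integral_cos_int_mul_eq_zero {k : ℤ} (hk : k ≠ 0) :
    ∫ x in (-π)..π, Real.cos (k * x) = 0 := by
  have hk' : (k : ℝ) ≠ 0 := by exact_mod_cast hk
  rw [intervalIntegral.integral_comp_mul_left (fun x => Real.cos x) hk', integral_cos]
  simp [Real.sin_int_mul_pi]

/-- Orthogonality of `cos (k x)` and `cos (m x)` over a period, in bilinear form. -/
theorem integral_cos_combination_mul {k m : ℤ} (hk : k ≠ 0) (hm : m ≠ 0)
    (hadd : k + m ≠ 0) (hsub : k - m ≠ 0) (a b c d : ℝ) :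
    ∫ x in (-π)..π, (a * Real.cos (k * x) + b * Real.cos (m * x)) *
      (c * Real.cos (k * x) + d * Real.cos (m * x)) = π * (a * c + b * d) := by
  have hint (j : ℤ) (r : ℝ) : IntervalIntegrable (fun x => r * Real.cos (j * x))
      MeasureTheory.volume (-π) π :=
    Continuous.intervalIntegrable (by fun_prop) _ _
  have hzero {j : ℤ} (hj : j ≠ 0) (r : ℝ) : ∫ x in (-π)..π, r * Real.cos (j * x) = 0 := by
    rw [intervalIntegral.integral_const_mul, integral_cos_int_mul_eq_zero hj, mul_zero]
  have hexpand (x : ℝ) : (a * Real.cos (k * x) + b * Real.cos (m * x)) *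
      (c * Real.cos (k * x) + d * Real.cos (m * x)) =
      (a * c + b * d) / 2 + a * c / 2 * Real.cos ((2 * k : ℤ) * x) +
        b * d / 2 * Real.cos ((2 * m : ℤ) * x) +
        (a * d + b * c) / 2 * Real.cos ((k + m : ℤ) * x) +
        (a * d + b * c) / 2 * Real.cos ((k - m : ℤ) * x) := by
    push_cast
    rw [mul_assoc 2 (k : ℝ), mul_assoc 2 (m : ℝ), add_mul (k : ℝ), sub_mul, Real.cos_two_mul,
      Real.cos_two_mul, Real.cos_add, Real.cos_sub]
    ring
  simp_rw [hexpand]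
  have hconst : IntervalIntegrable (fun _ : ℝ => (a * c + b * d) / 2)
      MeasureTheory.volume (-π) π := intervalIntegrable_const
  rw [intervalIntegral.integral_add
      (((hconst.add (hint _ _)).add (hint _ _)).add (hint _ _)) (hint _ _),
    intervalIntegral.integral_add ((hconst.add (hint _ _)).add (hint _ _)) (hint _ _),
    intervalIntegral.integral_add (hconst.add (hint _ _)) (hint _ _),
    intervalIntegral.integral_add hconst (hint _ _),
    hzero (by lia), hzero (by lia), hzero hadd, hzero hsub, intervalIntegral.integral_const,
    smul_eq_mul]
  ring

/-- For `n ≥ 3` and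
`p(x) = (n/2)(cos((n+1)x)/(n+2) + cos((n−1)x)/(n−2))`, one has
`∫ cos²(nx)cos²(x) − ∫ cos(nx)p(x)cos(x) = −2π/(n²−4) < 0` (integrals over `[−π,π]`);
hence the second-order coefficient `σ₂` of the eigenvalue branch `σ(a)` is negative. -/
theorem second_order_coefficient_even_negative
    (n : ℕ) (hn : 3 ≤ n) (p : ℝ → ℝ)
    (hp : ∀ x, p x = ((n : ℝ) / 2) *
      (Real.cos (((n : ℝ) + 1) * x) / ((n : ℝ) + 2) +
        Real.cos (((n : ℝ) - 1) * x) / ((n : ℝ) - 2))) :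
    (∫ x in (-π)..π, Real.cos (n * x) ^ 2 * Real.cos x ^ 2) -
      (∫ x in (-π)..π, Real.cos (n * x) * p x * Real.cos x) =
      -2 * π / ((n : ℝ) ^ 2 - 4) ∧
    (∫ x in (-π)..π, Real.cos (n * x) ^ 2 * Real.cos x ^ 2) -
      (∫ x in (-π)..π, Real.cos (n * x) * p x * Real.cos x) < 0 := by
  have hn' : (3 : ℝ) ≤ n := by exact_mod_cast hn
  have hpos : (0 : ℝ) < (n : ℝ) ^ 2 - 4 := by nlinarith
  have hcos (x : ℝ) : Real.cos (n * x) * Real.cos x =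
      1 / 2 * Real.cos ((n + 1 : ℤ) * x) + 1 / 2 * Real.cos ((n - 1 : ℤ) * x) := by
    push_cast
    rw [add_mul, sub_mul, one_mul, Real.cos_add, Real.cos_sub]
    ring
  have horth := integral_cos_combination_mul (k := n + 1) (m := n - 1)
    (by lia) (by lia) (by lia) (by lia) (1 / 2) (1 / 2)
  have hfirst : ∫ x in (-π)..π, Real.cos (n * x) ^ 2 * Real.cos x ^ 2 = π / 2 := by
    simp_rw [← mul_pow, hcos, sq]
    rw [horth]
    ring
  have hsecond : ∫ x in (-π)..π, Real.cos (n * x) * p x * Real.cos x =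
      π * (1 / 2 * (n / 2 / (n + 2)) + 1 / 2 * (n / 2 / (n - 2))) := by
    rw [← horth]
    refine intervalIntegral.integral_congr fun x _ => ?_
    simp only [← hcos, hp]
    push_cast
    ring
  have hvalue : (∫ x in (-π)..π, Real.cos (n * x) ^ 2 * Real.cos x ^ 2) -
      (∫ x in (-π)..π, Real.cos (n * x) * p x * Real.cos x) =
      -2 * π / ((n : ℝ) ^ 2 - 4) := by
    rw [hfirst, hsecond]
    have hadd : (n : ℝ) + 2 ≠ 0 := by linarith
    have hsub : (n : ℝ) - 2 ≠ 0 := by linarith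
    have hne := hpos.ne'
    field_simp
    ring
  refine ⟨hvalue, ?_⟩
  rw [hvalue]
  exact div_neg_of_neg_of_pos (by linarith [Real.pi_pos]) hpos
end

section
/- Let n ≥ 3 be an integer and define q : ℝ → ℝ by q(x) = (n/2)·(sin((n+1)x)/(n+2) − sin((n−1)x)/(n−2)). Then q is odd, q''(x) + q(x) + n²·cos(n·x)·sin(x) = 0 for all x ∈ ℝ, and ∫_{−π}^{π} q(x)·sin(x) dx = 0. (Thus q is the unique odd solution orthogonal to sin of the first-order perturbation equation −v₁'' = v₁ + n² cos(nx) sin(x).) -/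
open Real

/-- Sines of integer frequency `k ≠ ±1` are orthogonal to `sin` over a period. -/
theorem integral_sin_int_mul_mul_sin_eq_zero {k : ℤ} (h₁ : k ≠ 1) (h₂ : k ≠ -1) :
    ∫ x in (-π)..π, Real.sin (k * x) * Real.sin x = 0 := by
  have h : ∀ x : ℝ, Real.sin (k * x) * Real.sin x =
      1 / 2 * (Real.cos (((k - 1 : ℤ) : ℝ) * x) - Real.cos (((k + 1 : ℤ) : ℝ) * x)) := by
    intro x
    push_cast
    rw [sub_mul, add_mul, one_mul, Real.cos_sub, Real.cos_add]
    ring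
  simp_rw [h]
  rw [intervalIntegral.integral_const_mul, intervalIntegral.integral_sub
      (Continuous.intervalIntegrable (by fun_prop) _ _)
      (Continuous.intervalIntegrable (by fun_prop) _ _),
    integral_cos_int_mul_eq_zero (by lia), integral_cos_int_mul_eq_zero (by lia)]
  simp

/-- The second derivative of a linear combination of two sines. -/
theorem deriv_deriv_sin_mul_add_sin_mul (a b c d x : ℝ) :
    deriv (deriv fun y => a * Real.sin (c * y) + b * Real.sin (d * y)) x =
      -(a * c ^ 2 * Real.sin (c * x) + b * d ^ 2 * Real.sin (d * x)) := by
  have hlin : ∀ e y : ℝ, HasDerivAt (fun z => e * z) e y := fun e y => by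
    simpa using (hasDerivAt_id y).const_mul e
  have h₁ : deriv (fun y => a * Real.sin (c * y) + b * Real.sin (d * y)) =
      fun y => a * (Real.cos (c * y) * c) + b * (Real.cos (d * y) * d) :=
    funext fun y => (((hlin c y).sin.const_mul a).add ((hlin d y).sin.const_mul b)).deriv
  rw [h₁]
  have h₂ := ((((hlin c x).cos.mul_const c).const_mul a).add
    (((hlin d x).cos.mul_const d).const_mul b)).deriv
  refine h₂.trans ?_
  ring

/-- For `n ≥ 3`, the function
`q(x) = (n/2)(sin((n+1)x)/(n+2) − sin((n−1)x)/(n−2))` is odd, solves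
`q'' + q + n²cos(nx)sin(x) = 0`, and is orthogonal to `sin` on `[−π,π]`. -/
theorem first_order_perturbation_odd
    (n : ℕ) (hn : 3 ≤ n) (q : ℝ → ℝ)
    (hq : ∀ x, q x = ((n : ℝ) / 2) *
      (Real.sin (((n : ℝ) + 1) * x) / ((n : ℝ) + 2) -
        Real.sin (((n : ℝ) - 1) * x) / ((n : ℝ) - 2))) :
    (∀ x, q (-x) = -q x) ∧
    (∀ x, deriv (deriv q) x + q x + (n : ℝ) ^ 2 * Real.cos (n * x) * Real.sin x = 0) ∧
    (∫ x in (-π)..π, q x * Real.sin x) = 0 := by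
  have hn' : (3 : ℝ) ≤ n := by exact_mod_cast hn
  have hp : (n : ℝ) + 2 ≠ 0 := by positivity
  have hm : (n : ℝ) - 2 ≠ 0 := by linarith
  have hq' : q = fun x => (n / 2 / (n + 2) : ℝ) * Real.sin (((n : ℝ) + 1) * x) +
      (-(n / 2 / (n - 2)) : ℝ) * Real.sin (((n : ℝ) - 1) * x) := by
    funext x
    rw [hq]
    ring
  refine ⟨fun x => ?_, fun x => ?_, ?_⟩
  · simp only [hq, mul_neg, Real.sin_neg]
    ring
  · rw [hq', deriv_deriv_sin_mul_add_sin_mul]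
    simp only [add_mul, sub_mul, one_mul, Real.sin_add, Real.sin_sub]
    field_simp
    ring
  · have h₁ := integral_sin_int_mul_mul_sin_eq_zero (k := n + 1) (by lia) (by lia)
    have h₂ := integral_sin_int_mul_mul_sin_eq_zero (k := n - 1) (by lia) (by lia)
    push_cast at h₁ h₂
    simp only [hq', add_mul (_ * Real.sin _), mul_assoc _ (Real.sin _) (Real.sin _)]
    rw [intervalIntegral.integral_add
      (Continuous.intervalIntegrable (by fun_prop) _ _)
      (Continuous.intervalIntegrable (by fun_prop) _ _),
      intervalIntegral.integral_const_mul, intervalIntegral.integral_const_mul, h₁, h₂]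
    simp
end

section
/- For every integer m ≥ 1, every α ∈ (0, 1/4], and every integer n ≥ 2, there exists an infinitely differentiable function S : ℝ → ℝ with the following properties: (1) S(π − θ) = −S(θ) for all θ ∈ [0, π]; (2) S(θ) = 0 for θ ∈ [π/2 + 1/(mn)², π]; (3) S(θ) = −m·cos(θ)·sin^{m−1}(θ) for θ ∈ [π/2, π/2 + α/(mn)²]; (4) 0 ≤ S(θ) ≤ 1/(m·n²) for θ ∈ [π/2, π]; (5) −m(1 + 4α) ≤ S'(θ) ≤ m for θ ∈ [π/2, π]. -/
open Real

/-- For `0 < a < 1`, a smooth cutoff equal to `1` on `(-∞, a]` and to `0` on `[1, ∞)` whose slope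
is nowhere steeper than `-c`, for any prescribed `c` with `c * (1 - a) > 1`. -/
theorem exists_contDiff_cutoff_of_slope {a c : ℝ} (hc : 0 < c) (hac : 1 < c * (1 - a)) :
    ∃ χ ψ : ℝ → ℝ, ContDiff ℝ (⊤ : ℕ∞) χ ∧ (∀ s, HasDerivAt χ (-ψ s) s) ∧
      (∀ s, 0 ≤ ψ s) ∧ (∀ s, ψ s ≤ c) ∧ (∀ s, 1 ≤ s → ψ s = 0) ∧
      (∀ s, s ≤ a → χ s = 1) ∧ (∀ s, 1 ≤ s → χ s = 0) := by
  have hr : 1 / (2 * c) < (1 - a) / 2 := by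
    rw [div_lt_div_iff₀ (by positivity) (by norm_num)]
    linarith
  let b : ContDiffBump ((1 + a) / 2 : ℝ) := ⟨1 / (2 * c), (1 - a) / 2, by positivity, hr⟩
  let ψ : ℝ → ℝ := b.normed MeasureTheory.volume
  have hψ : ContDiff ℝ (⊤ : ℕ∞) ψ := b.contDiff_normed
  have hsupp : Function.support ψ ⊆ Set.Ioo a 1 := by
    have : Function.support ψ = _ := b.support_normed_eq
    rw [this, Real.ball_eq_Ioo]
    apply Set.Ioo_subset_Ioo <;> simp only [b] <;> linarith
  have hψ0 : ∀ s, 1 ≤ s → ψ s = 0 := fun s hs ↦ by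
    by_contra h
    exact absurd (hsupp h).2 (not_lt.mpr hs)
  have hderiv : ∀ s, HasDerivAt (fun s ↦ ∫ x in s..1, ψ x) (-ψ s) s := fun s ↦
    intervalIntegral.integral_hasDerivAt_left (hψ.continuous.intervalIntegrable _ _)
      (hψ.continuous.stronglyMeasurableAtFilter _ _) hψ.continuous.continuousAt
  refine ⟨fun s ↦ ∫ x in s..1, ψ x, ψ, ?_, hderiv, b.nonneg_normed, fun s ↦ ?_, hψ0, ?_, ?_⟩
  · rw [contDiff_infty_iff_deriv]
    refine ⟨fun s ↦ (hderiv s).differentiableAt, ?_⟩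
    rw [show deriv (fun s ↦ ∫ x in s..1, ψ x) = fun s ↦ -ψ s from
      funext fun s ↦ (hderiv s).deriv]
    exact hψ.neg
  · refine (b.normed_le_div_measure_closedBall_rIn MeasureTheory.volume s).trans_eq ?_
    rw [MeasureTheory.measureReal_def, Real.volume_closedBall,
      ENNReal.toReal_ofReal (by simp only [b]; positivity)]
    simp only [b]
    field_simp
  · intro s hs
    exact (intervalIntegral.integral_eq_integral_of_support_subset
      (hsupp.trans fun x hx ↦ ⟨hs.trans_lt hx.1, hx.2.le⟩)).trans b.integral_normed
  · intro s hs
    beta_reduce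
    rw [intervalIntegral.integral_congr (g := fun _ ↦ (0 : ℝ)), intervalIntegral.integral_zero]
    intro x hx
    rw [Set.uIcc_of_ge hs] at hx
    exact hψ0 x hx.1

theorem hasDerivAt_neg_cos_mul_sin_pow (k : ℕ) (θ : ℝ) :
    HasDerivAt (fun θ ↦ -((k : ℝ) + 1) * cos θ * sin θ ^ k)
      (((k : ℝ) + 1) * (sin θ ^ (k + 1) - k * cos θ ^ 2 * sin θ ^ (k - 1))) θ := by
  refine (((hasDerivAt_cos θ).const_mul (-((k : ℝ) + 1))).mul
    ((hasDerivAt_sin θ).pow k)).congr_deriv ?_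
  simp only [Pi.pow_apply]
  ring

theorem neg_cos_le_sub_pi_div_two {θ : ℝ} (hθ : π / 2 ≤ θ) : -cos θ ≤ θ - π / 2 := by
  rw [← Real.sin_sub_pi_div_two]
  exact Real.sin_le (by linarith)

theorem mul_cos_sq_sin_pow_le {k : ℕ} {θ : ℝ} (hsin : 0 ≤ sin θ)
    (hcos : ((k : ℝ) + 1) * cos θ ^ 2 ≤ 1) :
    k * cos θ ^ 2 * sin θ ^ (k - 1) ≤ sin θ ^ (k + 1) := by
  rcases k with _ | k
  · simpa using hsin
  · have h : ((k + 1 : ℕ) : ℝ) * cos θ ^ 2 ≤ sin θ ^ 2 := by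
      nlinarith [Real.sin_sq_add_cos_sq θ]
    calc ((k + 1 : ℕ) : ℝ) * cos θ ^ 2 * sin θ ^ k ≤ sin θ ^ 2 * sin θ ^ k := by gcongr
      _ = sin θ ^ (k + 1 + 1) := by ring

/-- (Construction of `S_{m,n,α}`.) For every `m ≥ 1`, `α ∈ (0,1/4]` and
`n ≥ 2` there is a `C^∞` function `S : ℝ → ℝ` which is antisymmetric about `π/2` on
`[0,π]`, vanishes on `[π/2 + 1/(mn)², π]`, equals `−m cosθ sin^{m−1}θ` on
`[π/2, π/2 + α/(mn)²]`, satisfies `0 ≤ S ≤ 1/(mn²)` and `−m(1+4α) ≤ S' ≤ m` on `[π/2, π]`. -/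
theorem construction_S_mna
    (m : ℕ) (hm : 1 ≤ m) (α : ℝ) (hα : α ∈ Set.Ioc (0 : ℝ) (1 / 4))
    (n : ℕ) (hn : 2 ≤ n) :
    ∃ S : ℝ → ℝ, ContDiff ℝ (⊤ : ℕ∞) S ∧
      (∀ θ ∈ Set.Icc (0 : ℝ) π, S (π - θ) = -S θ) ∧
      (∀ θ ∈ Set.Icc (π / 2 + 1 / ((m : ℝ) * n) ^ 2) π, S θ = 0) ∧
      (∀ θ ∈ Set.Icc (π / 2) (π / 2 + α / ((m : ℝ) * n) ^ 2),
        S θ = -(m : ℝ) * Real.cos θ * Real.sin θ ^ (m - 1)) ∧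
      (∀ θ ∈ Set.Icc (π / 2) π, 0 ≤ S θ ∧ S θ ≤ 1 / ((m : ℝ) * (n : ℝ) ^ 2)) ∧
      (∀ θ ∈ Set.Icc (π / 2) π,
        -(m : ℝ) * (1 + 4 * α) ≤ deriv S θ ∧ deriv S θ ≤ (m : ℝ)) := by
  obtain ⟨hα0, hα1⟩ := hα
  obtain ⟨k, rfl⟩ : ∃ k, m = k + 1 := ⟨m - 1, by omega⟩
  obtain ⟨χ, ψ, hχ, hχ', hψ0, hψc, hψ1, hχa, hχ1⟩ :=
    exists_contDiff_cutoff_of_slope (a := α) (c := 1 + 4 * α) (by positivity) (by nlinarith)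
  have hanti : Antitone χ := antitone_of_deriv_nonpos (fun s ↦ (hχ' s).differentiableAt)
    fun s ↦ by rw [(hχ' s).deriv]; exact neg_nonpos.mpr (hψ0 s)
  have hχ_nonneg : ∀ s, 0 ≤ χ s := fun s ↦ by
    rw [← hχ1 (max s 1) (le_max_right _ _)]
    exact hanti (le_max_left _ _)
  have hχ_le : ∀ s, χ s ≤ 1 := fun s ↦ by
    rw [← hχa (min s α) (min_le_right _ _)]
    exact hanti (min_le_left _ _)
  have hn' : (1 : ℝ) ≤ n := by exact_mod_cast (by omega : 1 ≤ n)
  have hk : (0 : ℝ) ≤ k := k.cast_nonneg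
  push_cast
  set N : ℝ := (((k : ℝ) + 1) * n) ^ 2 with hN
  have hkN : (k : ℝ) + 1 ≤ N := by
    have : (k : ℝ) + 1 ≤ ((k : ℝ) + 1) * n := by nlinarith
    nlinarith
  have hN0 : 0 < N := by linarith
  let f : ℝ → ℝ := fun θ ↦ -((k : ℝ) + 1) * cos θ * sin θ ^ k
  let S : ℝ → ℝ := fun θ ↦ f θ * χ (N * (θ - π / 2)) * χ (-(N * (θ - π / 2)))
  have hS : ∀ θ, -(N * (θ - π / 2)) ≤ α → S θ = f θ * χ (N * (θ - π / 2)) := fun θ h ↦ by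
    simp only [S, hχa _ h, mul_one]
  have hS' : ∀ θ, π / 2 ≤ θ → S θ = f θ * χ (N * (θ - π / 2)) := fun θ h ↦
    hS θ (by nlinarith [mul_nonneg hN0.le (sub_nonneg.mpr h)])
  have hsin : ∀ θ ∈ Set.Icc (π / 2) π, 0 ≤ sin θ := fun θ h ↦
    sin_nonneg_of_nonneg_of_le_pi (by linarith [h.1, pi_pos]) h.2
  have hcos : ∀ θ ∈ Set.Icc (π / 2) π, cos θ ≤ 0 := fun θ h ↦
    cos_nonpos_of_pi_div_two_le_of_le h.1 (by linarith [h.2, pi_pos])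
  have hf0 : ∀ θ ∈ Set.Icc (π / 2) π, 0 ≤ f θ := fun θ h ↦
    mul_nonneg (mul_nonneg_of_nonpos_of_nonpos (by linarith) (hcos θ h)) (pow_nonneg (hsin θ h) _)
  have hf1 : ∀ θ ∈ Set.Icc (π / 2) π, f θ ≤ ((k : ℝ) + 1) * (θ - π / 2) := fun θ h ↦ by
    have h1 : 0 ≤ ((k : ℝ) + 1) * -cos θ := mul_nonneg (by linarith) (by linarith [hcos θ h])
    calc f θ = ((k : ℝ) + 1) * -cos θ * sin θ ^ k := by simp only [f]; ring
      _ ≤ ((k : ℝ) + 1) * -cos θ * 1 := by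
        gcongr
        exact pow_le_one₀ (hsin θ h) (sin_le_one θ)
      _ ≤ ((k : ℝ) + 1) * (θ - π / 2) := by
        rw [mul_one]
        gcongr
        exact neg_cos_le_sub_pi_div_two h.1
  refine ⟨S, ?_, ?_, ?_, ?_, ?_, ?_⟩
  · have : ContDiff ℝ (⊤ : ℕ∞) f := by fun_prop
    have : ContDiff ℝ (⊤ : ℕ∞) fun θ ↦ χ (N * (θ - π / 2)) := hχ.comp (by fun_prop)
    have : ContDiff ℝ (⊤ : ℕ∞) fun θ ↦ χ (-(N * (θ - π / 2))) := hχ.comp (by fun_prop)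
    fun_prop
  · intro θ _
    have h : N * (π - θ - π / 2) = -(N * (θ - π / 2)) := by ring
    simp only [S, f, h, neg_neg, cos_pi_sub, sin_pi_sub]
    ring
  · intro θ h
    have h1 : 1 ≤ N * (θ - π / 2) := by
      rw [mul_comm, ← div_le_iff₀ hN0]
      linarith [h.1]
    simp only [S, hχ1 _ h1, mul_zero, zero_mul]
  · intro θ h
    have h1 : N * (θ - π / 2) ≤ α := by
      rw [mul_comm, ← le_div_iff₀ hN0]
      linarith [h.2]
    rw [hS' θ h.1, hχa _ h1, mul_one]
  · intro θ h
    rw [hS' θ h.1]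
    refine ⟨mul_nonneg (hf0 θ h) (hχ_nonneg _), ?_⟩
    rcases le_total 1 (N * (θ - π / 2)) with h1 | h1
    · rw [hχ1 _ h1, mul_zero]
      positivity
    · calc f θ * χ (N * (θ - π / 2)) ≤ f θ * 1 := by
            gcongr
            · exact hf0 θ h
            · exact hχ_le _
        _ ≤ ((k : ℝ) + 1) * (1 / N) := by
            rw [mul_one]
            refine (hf1 θ h).trans ?_
            gcongr
            rwa [le_div_iff₀ hN0, mul_comm]
        _ = 1 / (((k : ℝ) + 1) * (n : ℝ) ^ 2) := by
            rw [hN]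
            field_simp
  · intro θ h
    set s := N * (θ - π / 2) with hs
    set f' := ((k : ℝ) + 1) * (sin θ ^ (k + 1) - k * cos θ ^ 2 * sin θ ^ (k - 1)) with hf'
    have hd : HasDerivAt S (f' * χ s + f θ * (-ψ s * N)) θ := by
      have h1 : HasDerivAt (fun θ ↦ N * (θ - π / 2)) N θ := by
        simpa using ((hasDerivAt_id θ).sub_const (π / 2)).const_mul N
      have h2 : HasDerivAt (fun θ ↦ χ (N * (θ - π / 2))) (-ψ s * N) θ := (hχ' s).comp θ h1
      refine ((hasDerivAt_neg_cos_mul_sin_pow k θ).mul h2).congr_of_eventuallyEq ?_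
      have h3 : ∀ᶠ x in nhds θ, -(N * (x - π / 2)) < α := by
        refine ContinuousAt.eventually_lt (by fun_prop) continuousAt_const ?_
        nlinarith [mul_nonneg hN0.le (sub_nonneg.mpr h.1)]
      filter_upwards [h3] with x hx using hS x hx.le
    rw [hd.deriv]
    have hf'_le : f' ≤ (k : ℝ) + 1 := by
      have h1 : sin θ ^ (k + 1) ≤ 1 := pow_le_one₀ (hsin θ h) (sin_le_one θ)
      have h2 : 0 ≤ k * cos θ ^ 2 * sin θ ^ (k - 1) :=
        mul_nonneg (by positivity) (pow_nonneg (hsin θ h) _)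
      exact mul_le_of_le_one_right (by linarith) (by linarith)
    have hneg : 0 ≤ f θ * (ψ s * N) := mul_nonneg (hf0 θ h) (mul_nonneg (hψ0 s) hN0.le)
    constructor
    · rcases le_total 1 s with h1 | h1
      · rw [hχ1 _ h1, hψ1 _ h1]
        nlinarith [mul_nonneg hk hα0.le]
      · have hθ : 0 ≤ θ - π / 2 := by linarith [h.1]
        have hcos2 : ((k : ℝ) + 1) * cos θ ^ 2 ≤ 1 := by
          have h2 := neg_cos_le_sub_pi_div_two h.1
          have h3 := hcos θ h
          have h4 : ((k : ℝ) + 1) * -cos θ ≤ 1 :=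
            (mul_le_mul hkN h2 (by linarith) hN0.le).trans h1
          nlinarith [neg_one_le_cos θ]
        have hf'0 : 0 ≤ f' := mul_nonneg (by linarith)
          (sub_nonneg.mpr (mul_cos_sq_sin_pow_le (hsin θ h) hcos2))
        have h5 : f θ * (ψ s * N) ≤ ((k : ℝ) + 1) * (1 + 4 * α) :=
          calc f θ * (ψ s * N) ≤ ((k : ℝ) + 1) * (θ - π / 2) * (ψ s * N) :=
                mul_le_mul_of_nonneg_right (hf1 θ h) (mul_nonneg (hψ0 s) hN0.le)
            _ = ((k : ℝ) + 1) * (s * ψ s) := by rw [hs]; ring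
            _ ≤ ((k : ℝ) + 1) * (1 * (1 + 4 * α)) := by
                gcongr
                · exact hψ0 s
                · exact hψc s
            _ = ((k : ℝ) + 1) * (1 + 4 * α) := by ring
        nlinarith [mul_nonneg hf'0 (hχ_nonneg s)]
    · have h1 : f' * χ s ≤ ((k : ℝ) + 1) * 1 :=
        mul_le_mul hf'_le (hχ_le s) (hχ_nonneg s) (by linarith)
      linarith
end

section
/- For every integer m ≥ 1 and every α ∈ (0, 1/4], there exists N ∈ ℕ such that for every integer n ≥ N there exists an infinitely differentiable function R : ℝ → ℝ with the following properties: (1) R(π − θ) = −R(θ) for all θ ∈ [0, π]; (2) R(θ) = 0 for θ ∈ [π/2 + 1/(mn), π]; (3) R(θ) = −m·cos(θ)·sin^{m−1}(θ) for θ ∈ [π/2, π/2 + α/(mn)²]; (4) |R(θ)| ≤ 2/(m·n²) for θ ∈ [π/2, π]; (5) −m(1 + 5α) ≤ R'(θ) ≤ m(1 + α) for θ ∈ [π/2, π]; (6) ∫_{π/2}^{π/2 + 1/(mn)} R(θ) dθ = 0; (7) ∫_{π/2}^{π/2 + 1/(mn)} |R(θ)| dθ ≤ 2m/(mn)³. 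-/
open Real

/-- A smooth cutoff on the half-line, supported in `[0, exp 4]`, whose logarithmic derivative
takes values in `[-1/2, 0]`. -/
structure IsLogCutoff (k : ℝ → ℝ) : Prop where
  contDiff : ContDiff ℝ (⊤ : ℕ∞) k
  eq_one : ∀ u, 0 ≤ u → u ≤ 1 → k u = 1
  eq_zero : ∀ u, exp 4 ≤ u → k u = 0
  nonneg : ∀ u, 0 ≤ k u
  le_one : ∀ u, k u ≤ 1
  deriv_nonpos : ∀ u, 0 ≤ u → deriv k u ≤ 0
  neg_half_le_mul_deriv : ∀ u, 0 ≤ u → -(1 / 2) ≤ u * deriv k u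

/-- A smooth antitone step from `1` to `0` across `[0, 4]`, with slope at least `-1/2`. -/
lemma exists_smooth_step :
    ∃ K ρ : ℝ → ℝ, ContDiff ℝ (⊤ : ℕ∞) K ∧ (∀ s, HasDerivAt K (-ρ s) s) ∧
      (∀ s, 0 ≤ ρ s ∧ ρ s ≤ 1 / 2) ∧ (∀ s ≤ 0, K s = 1) ∧ (∀ s, 4 ≤ s → K s = 0) := by
  let b : ContDiffBump (2 : ℝ) := ⟨1, 2, one_pos, one_lt_two⟩
  let ρ : ℝ → ℝ := b.normed MeasureTheory.volume
  have hρ : ContDiff ℝ (⊤ : ℕ∞) ρ := b.contDiff_normed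
  have hsupp : Function.support ρ = Set.Ioo 0 4 := by
    rw [show Function.support ρ = Metric.ball 2 2 from b.support_normed_eq, Real.ball_eq_Ioo]
    norm_num
  have hzero : ∀ s, s ≤ 0 → ρ s = 0 := by
    intro s hs
    by_contra h
    have : s ∈ Function.support ρ := h
    rw [hsupp] at this
    exact absurd this.1 (not_lt.2 hs)
  have hderiv : ∀ s, HasDerivAt (fun s => 1 - ∫ t in (0 : ℝ)..s, ρ t) (-ρ s) s := fun s =>
    (hρ.continuous.integral_hasStrictDerivAt 0 s).hasDerivAt.const_sub 1
  refine ⟨fun s => 1 - ∫ t in (0 : ℝ)..s, ρ t, ρ, ?_, hderiv, ?_, ?_, ?_⟩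
  · refine contDiff_infty_iff_deriv.2 ⟨fun s => (hderiv s).differentiableAt, ?_⟩
    rw [funext fun s => (hderiv s).deriv]
    exact hρ.neg
  · intro s
    refine ⟨b.nonneg_normed s, ?_⟩
    have := b.normed_le_div_measure_closedBall_rIn MeasureTheory.volume s
    simpa [MeasureTheory.measureReal_def, b] using this
  · intro s hs
    have : ∫ t in (0 : ℝ)..s, ρ t = ∫ t in (0 : ℝ)..s, (0 : ℝ) := by
      refine intervalIntegral.integral_congr fun t ht => hzero t ?_
      rw [Set.uIcc_of_ge hs] at ht
      exact ht.2
    simp [this]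
  · intro s hs
    have : ∫ t in (0 : ℝ)..s, ρ t = 1 := by
      rw [intervalIntegral.integral_eq_integral_of_support_subset]
      · exact b.integral_normed
      · rw [hsupp]
        exact fun t ht => ⟨ht.1, ht.2.le.trans hs⟩
    simp [this]

lemma exists_isLogCutoff : ∃ k : ℝ → ℝ, IsLogCutoff k := by
  obtain ⟨K, ρ, hK, hderiv, hρ, hone, hzero⟩ := exists_smooth_step
  have hanti : Antitone K := antitone_of_deriv_nonpos (fun s => (hderiv s).differentiableAt)
    fun s => by rw [(hderiv s).deriv]; linarith [(hρ s).1]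
  have heq : ∀ u, |u| ≤ 1 → K (log u) = 1 := by
    intro u hu
    rw [← log_abs]
    exact hone _ (log_nonpos (abs_nonneg u) hu)
  have hnear : (fun u => K (log u)) =ᶠ[nhds 0] fun _ => 1 := by
    filter_upwards [Metric.ball_mem_nhds (0 : ℝ) one_pos] with u hu
    exact heq u (by simpa using (Metric.mem_ball.1 hu).le)
  have hd : ∀ u, 0 < u → deriv (fun u => K (log u)) u = -ρ (log u) * u⁻¹ := fun u hu =>
    ((hderiv (log u)).comp u (hasDerivAt_log hu.ne')).deriv
  refine ⟨fun u => K (log u), ?_, ?_, ?_, ?_, ?_, ?_, ?_⟩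
  · refine contDiff_iff_contDiffAt.2 fun u => ?_
    rcases eq_or_ne u 0 with rfl | hu
    · exact contDiffAt_const.congr_of_eventuallyEq hnear
    · exact hK.contDiffAt.comp u (contDiffAt_log.2 hu)
  · exact fun u h0 h1 => heq u (by rwa [abs_of_nonneg h0])
  · exact fun u hu => hzero _ ((le_log_iff_exp_le ((exp_pos 4).trans_le hu)).2 hu)
  · intro u
    rw [← hzero (max 4 (log u)) (le_max_left _ _)]
    exact hanti (le_max_right _ _)
  · intro u
    rw [← hone (min 0 (log u)) (min_le_left _ _)]
    exact hanti (min_le_right _ _)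
  · intro u hu
    rcases hu.eq_or_lt with rfl | hu
    · rw [hnear.deriv_eq]; simp
    · rw [hd u hu, neg_mul, neg_nonpos]
      exact mul_nonneg (hρ _).1 (inv_nonneg.2 hu.le)
  · intro u hu
    rcases hu.eq_or_lt with rfl | hu
    · norm_num
    · rw [hd u hu, mul_left_comm, mul_inv_cancel₀ hu.ne']
      linarith [(hρ (log u)).2]

lemma IsLogCutoff.mul_sq_le {k : ℝ → ℝ} (hk : IsLogCutoff k) {u : ℝ} (hu : 0 ≤ u) :
    u * k u ^ 2 ≤ exp 4 := by
  rcases le_total (exp 4) u with h | h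
  · rw [hk.eq_zero u h]
    simpa using (exp_pos 4).le
  · have : k u ^ 2 ≤ 1 := pow_le_one₀ (hk.nonneg u) (hk.le_one u)
    nlinarith

lemma IsLogCutoff.integral_eq {k : ℝ → ℝ} (hk : IsLogCutoff k) {T : ℝ} (hT : exp 4 ≤ T) :
    ∫ u in (0 : ℝ)..T, k u = ∫ u in (0 : ℝ)..exp 4, k u := by
  have hc := hk.contDiff.continuous
  rw [← intervalIntegral.integral_add_adjacent_intervals (hc.intervalIntegrable 0 (exp 4))
    (hc.intervalIntegrable (exp 4) T)]
  have : ∫ u in exp 4..T, k u = ∫ u in exp 4..T, (0 : ℝ) := by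
    refine intervalIntegral.integral_congr fun t ht => hk.eq_zero t ?_
    rw [Set.uIcc_of_le hT] at ht
    exact ht.1
  simp [this]

lemma IsLogCutoff.integral_le {k : ℝ → ℝ} (hk : IsLogCutoff k) :
    ∫ u in (0 : ℝ)..exp 4, k u ≤ exp 4 := by
  have := intervalIntegral.integral_mono_on (exp_pos 4).le
    (hk.contDiff.continuous.intervalIntegrable (μ := MeasureTheory.volume) 0 (exp 4))
    ((continuous_const (y := (1 : ℝ))).intervalIntegrable 0 (exp 4)) fun u _ => hk.le_one u
  simpa using this

lemma exp_four_lt : exp 4 < 54.76 := by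
  have h : exp 4 = exp 1 ^ 4 := by rw [← exp_nat_mul]; norm_num
  rw [h]
  calc exp 1 ^ 4 < 2.7182818286 ^ 4 := by
        gcongr
        exact exp_one_lt_d9
    _ < 54.76 := by norm_num

/-- The potential `1 - sin ^ m`. -/
noncomputable def sinPowDefect (m : ℕ) (θ : ℝ) : ℝ := 1 - sin θ ^ m

/-- The derivative of `sinPowDefect m`. -/
noncomputable def sinPowSlope (m : ℕ) (θ : ℝ) : ℝ := -(m : ℝ) * cos θ * sin θ ^ (m - 1)

lemma hasDerivAt_sinPowDefect (m : ℕ) (θ : ℝ) :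
    HasDerivAt (sinPowDefect m) (sinPowSlope m θ) θ := by
  have := ((hasDerivAt_sin θ).pow m).const_sub 1
  exact this.congr_deriv (by rw [sinPowSlope]; ring)

lemma contDiff_sinPowDefect (m : ℕ) : ContDiff ℝ (⊤ : ℕ∞) (sinPowDefect m) := by
  unfold sinPowDefect
  fun_prop

lemma contDiff_sinPowSlope (m : ℕ) : ContDiff ℝ (⊤ : ℕ∞) (sinPowSlope m) := by
  unfold sinPowSlope
  fun_prop

lemma sinPowDefect_pi_sub (m : ℕ) (θ : ℝ) : sinPowDefect m (π - θ) = sinPowDefect m θ := by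
  simp [sinPowDefect, sin_pi_sub]

lemma sinPowSlope_pi_sub (m : ℕ) (θ : ℝ) : sinPowSlope m (π - θ) = -sinPowSlope m θ := by
  simp [sinPowSlope, sin_pi_sub, cos_pi_sub]

lemma sinPowDefect_pi_div_two (m : ℕ) : sinPowDefect m (π / 2) = 0 := by
  simp [sinPowDefect]

lemma sin_mem_of_mem {θ : ℝ} (hθ : θ ∈ Set.Icc (π / 2) π) : 0 ≤ sin θ ∧ sin θ ≤ 1 :=
  ⟨sin_nonneg_of_nonneg_of_le_pi (by linarith [hθ.1, pi_pos]) hθ.2, sin_le_one θ⟩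

lemma cos_nonpos_of_mem {θ : ℝ} (hθ : θ ∈ Set.Icc (π / 2) π) : cos θ ≤ 0 :=
  cos_nonpos_of_pi_div_two_le_of_le hθ.1 (by linarith [hθ.2, pi_pos])

lemma sinPowDefect_nonneg (m : ℕ) {θ : ℝ} (hθ : θ ∈ Set.Icc (π / 2) π) :
    0 ≤ sinPowDefect m θ :=
  sub_nonneg.2 (pow_le_one₀ (sin_mem_of_mem hθ).1 (sin_mem_of_mem hθ).2)

lemma sinPowSlope_nonneg (m : ℕ) {θ : ℝ} (hθ : θ ∈ Set.Icc (π / 2) π) :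
    0 ≤ sinPowSlope m θ := by
  have h := mul_nonneg (mul_nonneg m.cast_nonneg (neg_nonneg.2 (cos_nonpos_of_mem hθ)))
    (pow_nonneg (sin_mem_of_mem hθ).1 (m - 1))
  unfold sinPowSlope
  linarith

lemma sinPowDefect_monotoneOn (m : ℕ) : MonotoneOn (sinPowDefect m) (Set.Icc (π / 2) π) := by
  intro x hx y hy hxy
  have h : sin y ≤ sin x := by
    rw [← cos_sub_pi_div_two, ← cos_sub_pi_div_two]
    exact cos_le_cos_of_nonneg_of_le_pi (by linarith [hx.1]) (by linarith [hy.2, pi_pos])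
      (by linarith)
  exact sub_le_sub_left (pow_le_pow_left₀ (sin_mem_of_mem hy).1 h m) 1

lemma sinPowSlope_sq_le {m : ℕ} (hm : 1 ≤ m) {θ : ℝ} (hθ : θ ∈ Set.Icc (π / 2) π) :
    sinPowSlope m θ ^ 2 ≤ 2 * m * sinPowDefect m θ := by
  obtain ⟨p, rfl⟩ : ∃ p, m = p + 1 := ⟨m - 1, by omega⟩
  obtain ⟨h0, h1⟩ := sin_mem_of_mem hθ
  simp only [sinPowSlope, sinPowDefect, Nat.add_sub_cancel]
  have hc : cos θ ^ 2 = (1 - sin θ) * (1 + sin θ) := by rw [cos_sq']; ring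
  generalize sin θ = s at *
  have hgeom : ((p + 1 : ℕ) : ℝ) * s ^ p * (1 - s) ≤ 1 - s ^ (p + 1) := by
    rw [← geom_sum_mul_neg]
    refine mul_le_mul_of_nonneg_right ?_ (by linarith)
    have := Finset.card_nsmul_le_sum (Finset.range (p + 1)) (fun i => s ^ i) (s ^ p) fun i hi =>
      pow_le_pow_of_le_one h0 h1 (by simpa [Nat.lt_succ_iff] using hi)
    simpa using this
  have hp : s ^ p ≤ 1 := pow_le_one₀ h0 h1
  have hp0 : 0 ≤ s ^ p := pow_nonneg h0 p
  have hm0 : (0 : ℝ) ≤ (p + 1 : ℕ) := Nat.cast_nonneg _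
  calc (-((p + 1 : ℕ) : ℝ) * cos θ * s ^ p) ^ 2
      = ((p + 1 : ℕ) : ℝ) * ((1 + s) * s ^ p) * (((p + 1 : ℕ) : ℝ) * s ^ p * (1 - s)) := by
        rw [mul_pow, mul_pow, hc]; ring
    _ ≤ ((p + 1 : ℕ) : ℝ) * 2 * (1 - s ^ (p + 1)) := by
        refine mul_le_mul (mul_le_mul_of_nonneg_left ?_ hm0) hgeom ?_ (by positivity)
        · nlinarith
        · exact mul_nonneg (mul_nonneg hm0 hp0) (by linarith)
    _ = _ := by ring

lemma exists_hasDerivAt_sinPowSlope {m : ℕ} (hm : 1 ≤ m) {θ : ℝ} (hθ : θ ∈ Set.Icc (π / 2) π) :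
    ∃ d, HasDerivAt (sinPowSlope m) d θ ∧ d ≤ m ∧ (m * cos θ ^ 2 ≤ 1 → 0 ≤ d) := by
  obtain ⟨p, rfl⟩ : ∃ p, m = p + 1 := ⟨m - 1, by omega⟩
  obtain ⟨h0, h1⟩ := sin_mem_of_mem hθ
  have hd := ((hasDerivAt_cos θ).const_mul (-((p + 1 : ℕ) : ℝ))).mul ((hasDerivAt_sin θ).pow p)
  refine ⟨_, hd, ?_, fun h => ?_⟩
  · have h2 : 0 ≤ (p : ℝ) * sin θ ^ (p - 1) * cos θ ^ 2 := by positivity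
    have h3 : sin θ ^ (p + 1) ≤ 1 := pow_le_one₀ h0 h1
    have hm0 : (0 : ℝ) ≤ (p + 1 : ℕ) := Nat.cast_nonneg _
    have := mul_nonneg hm0 h2
    simp only [Pi.pow_apply]
    rw [pow_succ] at h3
    nlinarith [mul_le_mul_of_nonneg_left h3 hm0]
  · simp only [Pi.pow_apply]
    rcases p with _ | q
    · simpa using h0
    · have hs := sin_sq_add_cos_sq θ
      push_cast at h ⊢
      have h4 : 0 ≤ sin θ ^ 2 - ((q : ℝ) + 1) * cos θ ^ 2 := by linarith
      have h5 := mul_nonneg (mul_nonneg (by positivity : (0 : ℝ) ≤ (q : ℝ) + 1 + 1)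
        (pow_nonneg h0 q)) h4
      refine h5.trans_eq ?_
      ring

lemma sinPowDefect_add_le {m : ℕ} (x : ℝ) :
    sinPowDefect m (π / 2 + x) ≤ m * (x ^ 2 / 2) := by
  rw [sinPowDefect, add_comm, sin_add_pi_div_two]
  have h := one_add_mul_le_pow (a := cos x - 1) (by linarith [neg_one_le_cos x]) m
  rw [add_sub_cancel] at h
  nlinarith [one_sub_sq_div_two_le_cos (x := x), m.cast_nonneg (α := ℝ)]

lemma le_sinPowDefect_add {m : ℕ} (hm : 1 ≤ m) {x : ℝ} (h0 : 0 ≤ x) (hx : x ≤ π / 2) :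
    x ^ 2 / 5 ≤ sinPowDefect m (π / 2 + x) := by
  rw [sinPowDefect, add_comm, sin_add_pi_div_two]
  have hc : cos x ^ m ≤ cos x := by
    simpa using pow_le_pow_of_le_one (cos_nonneg_of_mem_Icc ⟨by linarith [pi_pos], hx⟩)
      (cos_le_one x) hm
  have h := cos_le_one_sub_mul_cos_sq (x := x) (by rw [abs_of_nonneg h0]; linarith [pi_pos])
  have hpi : (1 : ℝ) / 5 ≤ 2 / π ^ 2 := by
    rw [div_le_div_iff₀ (by norm_num) (by positivity)]
    nlinarith [pi_lt_d2, pi_pos]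
  nlinarith [sq_nonneg x]

/-- The profile `sinPowSlope m`, cut off where `sinPowDefect m` is of order `δ`. -/
noncomputable def cutProfile (k : ℝ → ℝ) (m : ℕ) (δ θ : ℝ) : ℝ :=
  sinPowSlope m θ * k (sinPowDefect m θ / δ)

namespace IsLogCutoff

variable {k : ℝ → ℝ} {m : ℕ} {δ θ : ℝ}

lemma contDiff_cutProfile (hk : IsLogCutoff k) (m : ℕ) (δ : ℝ) :
    ContDiff ℝ (⊤ : ℕ∞) (cutProfile k m δ) :=
  (contDiff_sinPowSlope m).mul (hk.contDiff.comp ((contDiff_sinPowDefect m).div_const δ))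

lemma cutProfile_nonneg (hk : IsLogCutoff k) (m : ℕ) (δ : ℝ) (hθ : θ ∈ Set.Icc (π / 2) π) :
    0 ≤ cutProfile k m δ θ :=
  mul_nonneg (sinPowSlope_nonneg m hθ) (hk.nonneg _)

lemma cutProfile_sq_le (hk : IsLogCutoff k) (hm : 1 ≤ m) (hδ : 0 < δ)
    (hθ : θ ∈ Set.Icc (π / 2) π) : cutProfile k m δ θ ^ 2 ≤ 2 * m * δ * exp 4 := by
  have hu := div_nonneg (sinPowDefect_nonneg m hθ) hδ.le
  calc cutProfile k m δ θ ^ 2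
      = sinPowSlope m θ ^ 2 * k (sinPowDefect m θ / δ) ^ 2 := mul_pow _ _ _
    _ ≤ 2 * m * sinPowDefect m θ * k (sinPowDefect m θ / δ) ^ 2 :=
        mul_le_mul_of_nonneg_right (sinPowSlope_sq_le hm hθ) (sq_nonneg _)
    _ = 2 * m * δ * (sinPowDefect m θ / δ * k (sinPowDefect m θ / δ) ^ 2) := by
        field_simp
    _ ≤ 2 * m * δ * exp 4 :=
        mul_le_mul_of_nonneg_left (hk.mul_sq_le hu) (by positivity)

lemma deriv_cutProfile_mem (hk : IsLogCutoff k) (hm : 1 ≤ m) (hδ : 0 < δ)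
    (hθ : θ ∈ Set.Icc (π / 2) π)
    (h : m * cos θ ^ 2 ≤ 1 ∨ k (sinPowDefect m θ / δ) = 0) :
    deriv (cutProfile k m δ) θ ∈ Set.Icc (-(m : ℝ)) m := by
  obtain ⟨d, hd, hdm, hd0⟩ := exists_hasDerivAt_sinPowSlope hm hθ
  have hF := sinPowDefect_nonneg m hθ
  have hu := div_nonneg hF hδ.le
  have hkd : HasDerivAt k (deriv k (sinPowDefect m θ / δ)) (sinPowDefect m θ / δ) :=
    (hk.contDiff.differentiable (by simp)).differentiableAt.hasDerivAt
  have hcomp : HasDerivAt (fun t => k (sinPowDefect m t / δ))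
      (deriv k (sinPowDefect m θ / δ) * (sinPowSlope m θ / δ)) θ :=
    hkd.comp θ ((hasDerivAt_sinPowDefect m θ).div_const δ)
  have hderiv : deriv (cutProfile k m δ) θ = d * k (sinPowDefect m θ / δ) +
      sinPowSlope m θ * (deriv k (sinPowDefect m θ / δ) * (sinPowSlope m θ / δ)) :=
    (hd.mul hcomp).deriv
  rw [hderiv]
  have hsq := div_le_div_of_nonneg_right (sinPowSlope_sq_le hm hθ) hδ.le
  have hsq0 : 0 ≤ sinPowSlope m θ ^ 2 / δ := by positivity
  have hrew : sinPowSlope m θ * (deriv k (sinPowDefect m θ / δ) * (sinPowSlope m θ / δ)) =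
      sinPowSlope m θ ^ 2 / δ * deriv k (sinPowDefect m θ / δ) := by ring
  rw [mul_div_assoc] at hsq
  rw [hrew]
  have h1 := hk.deriv_nonpos _ hu
  have h2 := hk.neg_half_le_mul_deriv _ hu
  have h3 := hk.nonneg (sinPowDefect m θ / δ)
  have h4 := hk.le_one (sinPowDefect m θ / δ)
  generalize sinPowDefect m θ / δ = u at *
  have hm0 : (0 : ℝ) ≤ m := Nat.cast_nonneg _
  constructor
  · have hdk : 0 ≤ d * k u := by
      rcases h with h | h
      · exact mul_nonneg (hd0 h) h3
      · simp [h]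
    have := mul_le_mul_of_nonpos_right hsq h1
    nlinarith
  · have hdk : d * k u ≤ m := by nlinarith
    have := mul_nonpos_of_nonneg_of_nonpos hsq0 h1
    linarith

lemma integral_cutProfile (hk : IsLogCutoff k) (m : ℕ) (hδ : 0 < δ)
    (hθ : exp 4 * δ ≤ sinPowDefect m θ) :
    ∫ t in (π / 2)..θ, cutProfile k m δ t = δ * ∫ u in (0 : ℝ)..exp 4, k u := by
  have h := intervalIntegral.integral_comp_mul_deriv (a := π / 2) (b := θ) (g := k)
    (fun t _ => (hasDerivAt_sinPowDefect m t).div_const δ)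
    ((contDiff_sinPowSlope m).continuous.div_const δ).continuousOn hk.contDiff.continuous
  rw [sinPowDefect_pi_div_two, zero_div, hk.integral_eq ((le_div_iff₀ hδ).2 hθ)] at h
  rw [← h, ← intervalIntegral.integral_const_mul]
  refine intervalIntegral.integral_congr fun t _ => ?_
  simp only [cutProfile, Function.comp]
  field_simp

end IsLogCutoff

/-- The normalized difference of two cut-offs of `sinPowSlope m`, at scales `δ` and `B`, whose
integrals over the right half of the support cancel. -/
noncomputable def balancedProfile (k : ℝ → ℝ) (m : ℕ) (δ B θ : ℝ) : ℝ :=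
  (cutProfile k m δ θ - δ / B * cutProfile k m B θ) / (1 - δ / B)

lemma abs_sub_div_le {x y c d : ℝ} (hx : 0 ≤ x) (hy : 0 ≤ y) (hxc : x ≤ c) (hyc : y ≤ c)
    (hd : 0 < d) : |(x - y) / d| ≤ c / d := by
  rw [abs_div, abs_of_pos hd]
  exact div_le_div_of_nonneg_right (abs_le.2 ⟨by linarith, by linarith⟩) hd.le

namespace IsLogCutoff

variable {k : ℝ → ℝ} {m : ℕ} {δ B θ θ₁ : ℝ}

lemma contDiff_balancedProfile (hk : IsLogCutoff k) (m : ℕ) (δ B : ℝ) :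
    ContDiff ℝ (⊤ : ℕ∞) (balancedProfile k m δ B) :=
  ((hk.contDiff_cutProfile m δ).sub
    (contDiff_const.mul (hk.contDiff_cutProfile m B))).div_const _

lemma balancedProfile_eq_zero (hk : IsLogCutoff k) (hδ : 0 < δ) (hδB : δ ≤ B)
    (hθ : exp 4 * B ≤ sinPowDefect m θ) : balancedProfile k m δ B θ = 0 := by
  have hB := hδ.trans_le hδB
  have h1 := hk.eq_zero _ ((le_div_iff₀ hB).2 hθ)
  have h2 := hk.eq_zero _ ((le_div_iff₀ hδ).2
    ((mul_le_mul_of_nonneg_left hδB (exp_pos 4).le).trans hθ))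
  simp [balancedProfile, cutProfile, h1, h2]

lemma balancedProfile_eq (hk : IsLogCutoff k) (hδ : 0 < δ) (hδB : δ < B)
    (hθ : θ ∈ Set.Icc (π / 2) π) (h : sinPowDefect m θ ≤ δ) :
    balancedProfile k m δ B θ = sinPowSlope m θ := by
  have hB := hδ.trans hδB
  have hF := sinPowDefect_nonneg m hθ
  have h1 := hk.eq_one _ (div_nonneg hF hδ.le) ((div_le_one hδ).2 h)
  have h2 := hk.eq_one _ (div_nonneg hF hB.le) ((div_le_one hB).2 (h.trans hδB.le))
  have hne : 1 - δ / B ≠ 0 := (sub_pos.2 ((div_lt_one hB).2 hδB)).ne'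
  rw [balancedProfile, cutProfile, cutProfile, h1, h2, div_eq_iff hne]
  ring

lemma abs_balancedProfile_le (hk : IsLogCutoff k) (hm : 1 ≤ m) (hδ : 0 < δ) (hδB : δ < B)
    (hθ : θ ∈ Set.Icc (π / 2) π) {c : ℝ} (hc : 0 ≤ c) (h : 2 * m * δ * exp 4 ≤ c ^ 2) :
    |balancedProfile k m δ B θ| ≤ c / (1 - δ / B) := by
  have hB := hδ.trans hδB
  have hb1 := (div_lt_one hB).2 hδB
  have hb0 : 0 ≤ δ / B := by positivity
  have hsq := hk.cutProfile_sq_le hm hB hθ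
  refine abs_sub_div_le (hk.cutProfile_nonneg m δ hθ)
    (mul_nonneg hb0 (hk.cutProfile_nonneg m B hθ))
    (abs_le_of_sq_le_sq' ((hk.cutProfile_sq_le hm hδ hθ).trans h) hc).2
    (abs_le_of_sq_le_sq' ?_ hc).2 (sub_pos.2 hb1)
  calc (δ / B * cutProfile k m B θ) ^ 2
      ≤ (δ / B) ^ 2 * (2 * m * B * exp 4) := by
        rw [mul_pow]; exact mul_le_mul_of_nonneg_left hsq (sq_nonneg _)
    _ = δ / B * (2 * m * δ * exp 4) := by field_simp
    _ ≤ 1 * (2 * m * δ * exp 4) := mul_le_mul_of_nonneg_right hb1.le (by positivity)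
    _ ≤ c ^ 2 := by rwa [one_mul]

lemma abs_deriv_balancedProfile_le (hk : IsLogCutoff k) (hm : 1 ≤ m) (hδ : 0 < δ) (hδB : δ < B)
    (hθ : θ ∈ Set.Icc (π / 2) π)
    (h : m * cos θ ^ 2 ≤ 1 ∨ exp 4 * B ≤ sinPowDefect m θ) :
    |deriv (balancedProfile k m δ B) θ| ≤ m * (1 + δ / B) / (1 - δ / B) := by
  have hB := hδ.trans hδB
  have hb1 := (div_lt_one hB).2 hδB
  have hb0 : 0 ≤ δ / B := by positivity
  have h1 := hk.deriv_cutProfile_mem hm hδ hθ (h.imp_right fun h => hk.eq_zero _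
    ((le_div_iff₀ hδ).2 ((mul_le_mul_of_nonneg_left hδB.le (exp_pos 4).le).trans h)))
  have h2 := hk.deriv_cutProfile_mem hm hB hθ (h.imp_right fun h => hk.eq_zero _
    ((le_div_iff₀ hB).2 h))
  have hdiff : ∀ ε, DifferentiableAt ℝ (cutProfile k m ε) θ := fun ε =>
    ((hk.contDiff_cutProfile m ε).differentiable (by simp)).differentiableAt
  have hderiv : deriv (balancedProfile k m δ B) θ =
      (deriv (cutProfile k m δ) θ - δ / B * deriv (cutProfile k m B) θ) / (1 - δ / B) :=
    (((hdiff δ).hasDerivAt.sub ((hdiff B).hasDerivAt.const_mul (δ / B))).div_const _).deriv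
  rw [hderiv, abs_div, abs_of_pos (sub_pos.2 hb1)]
  refine div_le_div_of_nonneg_right ?_ (sub_pos.2 hb1).le
  have h3 := mul_le_mul_of_nonneg_left h2.1 hb0
  have h4 := mul_le_mul_of_nonneg_left h2.2 hb0
  exact abs_le.2 ⟨by linarith [h1.1], by linarith [h1.2]⟩

lemma integral_balancedProfile (hk : IsLogCutoff k) (hδ : 0 < δ) (hδB : δ ≤ B)
    (hθ : exp 4 * B ≤ sinPowDefect m θ) :
    ∫ t in (π / 2)..θ, balancedProfile k m δ B t = 0 := by
  have hB := hδ.trans_le hδB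
  have hint : ∀ ε, IntervalIntegrable (cutProfile k m ε) MeasureTheory.volume (π / 2) θ :=
    fun ε => (hk.contDiff_cutProfile m ε).continuous.intervalIntegrable _ _
  simp only [balancedProfile]
  rw [intervalIntegral.integral_div,
    intervalIntegral.integral_sub (hint δ) ((hint B).const_mul _),
    intervalIntegral.integral_const_mul, hk.integral_cutProfile m hB hθ,
    hk.integral_cutProfile m hδ ((mul_le_mul_of_nonneg_left hδB (exp_pos 4).le).trans hθ)]
  field_simp
  simp

lemma integral_abs_balancedProfile_le (hk : IsLogCutoff k) (hδ : 0 < δ) (hδB : δ < B)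
    (hθ : θ ∈ Set.Icc (π / 2) π) (h : exp 4 * B ≤ sinPowDefect m θ) :
    ∫ t in (π / 2)..θ, |balancedProfile k m δ B t| ≤ 2 * δ * exp 4 / (1 - δ / B) := by
  have hB := hδ.trans hδB
  have hd := sub_pos.2 ((div_lt_one hB).2 hδB)
  have hb0 : 0 ≤ δ / B := by positivity
  have hint : ∀ ε, IntervalIntegrable (cutProfile k m ε) MeasureTheory.volume (π / 2) θ :=
    fun ε => (hk.contDiff_cutProfile m ε).continuous.intervalIntegrable _ _
  have hle := intervalIntegral.integral_mono_on (μ := MeasureTheory.volume) hθ.1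
    ((hk.contDiff_balancedProfile m δ B).continuous.abs.intervalIntegrable (π / 2) θ)
    (((hint δ).add ((hint B).const_mul (δ / B))).div_const (1 - δ / B)) fun t ht => by
      have ht' : t ∈ Set.Icc (π / 2) π := ⟨ht.1, ht.2.trans hθ.2⟩
      have h1 := hk.cutProfile_nonneg m δ ht'
      have h2 := mul_nonneg hb0 (hk.cutProfile_nonneg m B ht')
      exact abs_sub_div_le h1 h2 (le_add_of_nonneg_right h2) (le_add_of_nonneg_left h1) hd
  refine hle.trans ?_
  rw [intervalIntegral.integral_div,
    intervalIntegral.integral_add (hint δ) ((hint B).const_mul _),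
    intervalIntegral.integral_const_mul, hk.integral_cutProfile m hB h,
    hk.integral_cutProfile m hδ ((mul_le_mul_of_nonneg_left hδB.le (exp_pos 4).le).trans h)]
  refine div_le_div_of_nonneg_right ?_ hd.le
  have hq := mul_le_mul_of_nonneg_left hk.integral_le hδ.le
  have : δ / B * (B * ∫ u in (0 : ℝ)..exp 4, k u) = δ * ∫ u in (0 : ℝ)..exp 4, k u := by
    field_simp
  linarith

end IsLogCutoff

/-- (Construction of `R_{m,n,α}`.) For every `m ≥ 1` and `α ∈ (0,1/4]`
there is `N` such that for all `n ≥ N` there is a `C^∞` function `R : ℝ → ℝ`,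
antisymmetric about `π/2` on `[0,π]`, vanishing on `[π/2 + 1/(mn), π]`, equal to
`−m cosθ sin^{m−1}θ` on `[π/2, π/2 + α/(mn)²]`, with `|R| ≤ 2/(mn²)` and
`−m(1+5α) ≤ R' ≤ m(1+α)` on `[π/2, π]`, zero mean on `[π/2, π/2 + 1/(mn)]`, and
`∫|R| ≤ 2m/(mn)³` there. -/
theorem construction_R_mna
    (m : ℕ) (hm : 1 ≤ m) (α : ℝ) (hα : α ∈ Set.Ioc (0 : ℝ) (1 / 4)) :
    ∃ N : ℕ, ∀ n : ℕ, N ≤ n →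
    ∃ R : ℝ → ℝ, ContDiff ℝ (⊤ : ℕ∞) R ∧
      (∀ θ ∈ Set.Icc (0 : ℝ) π, R (π - θ) = -R θ) ∧
      (∀ θ ∈ Set.Icc (π / 2 + 1 / ((m : ℝ) * n)) π, R θ = 0) ∧
      (∀ θ ∈ Set.Icc (π / 2) (π / 2 + α / ((m : ℝ) * n) ^ 2),
        R θ = -(m : ℝ) * Real.cos θ * Real.sin θ ^ (m - 1)) ∧
      (∀ θ ∈ Set.Icc (π / 2) π, |R θ| ≤ 2 / ((m : ℝ) * (n : ℝ) ^ 2)) ∧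
      (∀ θ ∈ Set.Icc (π / 2) π,
        -(m : ℝ) * (1 + 5 * α) ≤ deriv R θ ∧ deriv R θ ≤ (m : ℝ) * (1 + α)) ∧
      (∫ θ in (π / 2)..(π / 2 + 1 / ((m : ℝ) * n)), R θ) = 0 ∧
      (∫ θ in (π / 2)..(π / 2 + 1 / ((m : ℝ) * n)), |R θ|) ≤
        2 * (m : ℝ) / ((m : ℝ) * n) ^ 3 := by
  obtain ⟨k, hk⟩ := exists_isLogCutoff
  obtain ⟨hα0, hα1⟩ := hα
  refine ⟨400, fun n hn => ?_⟩
  have hn' : (400 : ℝ) ≤ n := by exact_mod_cast hn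
  have hm' : (1 : ℝ) ≤ m := by exact_mod_cast hm
  have hM : (400 : ℝ) ≤ m * n := by nlinarith
  have hM0 : (0 : ℝ) < m * n := by linarith
  set x : ℝ := 1 / ((m : ℝ) * n) with hx
  have hx0 : 0 < x := by positivity
  have hx1 : x ≤ 1 / 400 := one_div_le_one_div_of_le (by norm_num) hM
  have hmx : m * x ≤ 1 / 400 := by
    have : m * x = 1 / n := by rw [hx]; field_simp
    rw [this]
    exact one_div_le_one_div_of_le (by norm_num) hn'
  have hpi := pi_gt_three
  have hxpi : x ≤ π / 2 := by linarith
  have hα' : α / ((m : ℝ) * n) ^ 2 = α * x ^ 2 := by rw [hx]; field_simp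
  have hmem : π / 2 + x ∈ Set.Icc (π / 2) π := ⟨by linarith, by linarith⟩
  have hE := exp_four_lt
  have hE0 := exp_pos 4
  set δ : ℝ := m * (α * x ^ 2) ^ 2 / 2 with hδ
  have hδ0 : 0 < δ := by positivity
  set B : ℝ := sinPowDefect m (π / 2 + x) / exp 4 with hB
  have hEB : exp 4 * B = sinPowDefect m (π / 2 + x) := by rw [hB]; field_simp
  have hF := le_sinPowDefect_add hm hx0.le hxpi
  have hB0 : 0 < B := div_pos (lt_of_lt_of_le (by positivity) hF) hE0
  -- The ratio of the two scales is at most `α / 10`.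
  have hb : δ / B ≤ α / 10 := by
    rw [div_le_iff₀ hB0]
    have h1 : x ^ 2 / 5 ≤ 55 * B := by nlinarith
    have h2 : m * x ^ 2 ≤ 1 / 400 * (1 / 400) := by
      calc m * x ^ 2 = m * x * x := by ring
        _ ≤ _ := mul_le_mul hmx hx1 hx0.le (by norm_num)
    calc δ = α * (α * (m * x ^ 2) / 2 * x ^ 2) := by rw [hδ]; ring
      _ ≤ α * (1 / 4 * (1 / 400 * (1 / 400)) / 2 * x ^ 2) := by gcongr
      _ ≤ α * (B / 10) := by
          refine mul_le_mul_of_nonneg_left ?_ hα0.le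
          linarith
      _ = α / 10 * B := by ring
  have hb0 : 0 ≤ δ / B := by positivity
  have hδB : δ < B := (div_lt_one hB0).1 (by linarith)
  have hd : 0 < 1 - δ / B := by linarith
  have hfar : ∀ θ ∈ Set.Icc (π / 2 + x) π, exp 4 * B ≤ sinPowDefect m θ := fun θ hθ => by
    rw [hEB]
    exact sinPowDefect_monotoneOn m hmem ⟨hmem.1.trans hθ.1, hθ.2⟩ hθ.1
  refine ⟨balancedProfile k m δ B, hk.contDiff_balancedProfile m δ B, ?_, ?_, ?_, ?_, ?_, ?_, ?_⟩
  · intro θ _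
    simp only [balancedProfile, cutProfile, sinPowDefect_pi_sub, sinPowSlope_pi_sub]
    ring
  · exact fun θ hθ => hk.balancedProfile_eq_zero hδ0 hδB.le (hfar θ hθ)
  · intro θ hθ
    rw [hα'] at hθ
    have hαx : α * x ^ 2 ≤ x := by nlinarith
    have h0 : 0 ≤ θ - π / 2 := sub_nonneg.2 hθ.1
    refine hk.balancedProfile_eq hδ0 hδB ⟨hθ.1, by linarith [hθ.2, hmem.2]⟩ ?_
    have h := sinPowDefect_add_le (m := m) (θ - π / 2)
    rw [add_sub_cancel] at h
    refine h.trans ?_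
    rw [hδ, ← mul_div_assoc]
    gcongr
    linarith [hθ.2]
  · intro θ hθ
    have hrhs : 2 / ((m : ℝ) * (n : ℝ) ^ 2) = 2 * m * x ^ 2 := by rw [hx]; field_simp
    refine (hk.abs_balancedProfile_le hm hδ0 hδB hθ
      (c := 7.4 * (m * (α * x ^ 2))) (by positivity) ?_).trans ?_
    · calc 2 * m * δ * exp 4 = (m * (α * x ^ 2)) ^ 2 * exp 4 := by rw [hδ]; ring
        _ ≤ (m * (α * x ^ 2)) ^ 2 * 54.76 := by gcongr
        _ = (7.4 * (m * (α * x ^ 2))) ^ 2 := by ring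
    · rw [hrhs, div_le_iff₀ hd]
      calc 7.4 * (m * (α * x ^ 2)) = m * x ^ 2 * (7.4 * α) := by ring
        _ ≤ m * x ^ 2 * (2 * (1 - δ / B)) := by
            refine mul_le_mul_of_nonneg_left ?_ (by positivity)
            linarith
        _ = _ := by ring
  · intro θ hθ
    have hcos : m * cos θ ^ 2 ≤ 1 ∨ exp 4 * B ≤ sinPowDefect m θ := by
      rcases le_total θ (π / 2 + x) with h | h
      · left
        have hs : cos θ ^ 2 ≤ x ^ 2 := by
          rw [← sin_pi_div_two_sub, sq_le_sq, abs_of_pos hx0]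
          refine abs_sin_le_abs.trans ?_
          rw [abs_sub_comm, abs_of_nonneg (sub_nonneg.2 hθ.1)]
          linarith
        nlinarith
      · exact Or.inr (hfar θ ⟨h, hθ.2⟩)
    have h := hk.abs_deriv_balancedProfile_le hm hδ0 hδB hθ hcos
    have hle : m * (1 + δ / B) / (1 - δ / B) ≤ m * (1 + α) := by
      rw [mul_div_assoc]
      refine mul_le_mul_of_nonneg_left ?_ (by linarith)
      rw [div_le_iff₀ hd]
      nlinarith
    obtain ⟨h1, h2⟩ := abs_le.1 (h.trans hle)
    exact ⟨by nlinarith, h2⟩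
  · exact hk.integral_balancedProfile hδ0 hδB.le hEB.le
  · refine (hk.integral_abs_balancedProfile_le hδ0 hδB hmem hEB.le).trans ?_
    have hrhs : 2 * (m : ℝ) / ((m : ℝ) * n) ^ 3 = 2 * m * x ^ 3 := by rw [hx]; field_simp
    rw [hrhs, div_le_iff₀ hd]
    calc 2 * δ * exp 4 = m * x ^ 3 * (α ^ 2 * x * exp 4) := by rw [hδ]; ring
      _ ≤ m * x ^ 3 * ((1 / 4) ^ 2 * (1 / 400) * 54.76) := by gcongr
      _ ≤ m * x ^ 3 * (2 * (1 - δ / B)) := by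
          refine mul_le_mul_of_nonneg_left ?_ (by positivity)
          linarith
      _ = _ := by ring
end

section
/- For every integer m ≥ 1 and every α ∈ (0, 1/4], there exists N ∈ ℕ such that for every integer n ≥ N there exists an infinitely differentiable function P : ℝ → ℝ with the following properties: (1) P(π − θ) = P(θ) for all θ ∈ [0, π]; (2) P(θ) = 0 for θ ∈ [π/2 + 1/(mn), π]; (3) P(θ) = 1 − sin^m(θ) for θ ∈ [π/2, π/2 + α/(mn)²]; (4) 0 ≤ P(θ) ≤ 2m/(mn)³ and |P'(θ)| ≤ 2m/(mn)² for θ ∈ [π/2, π]; (5) −m(1 + 5α) ≤ P''(θ) ≤ m(1 + α) for θ ∈ [π/2, π]. -/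
open scoped ContDiff

/-- The primitive of a smooth function is smooth. -/
theorem contDiff_primitive {f : ℝ → ℝ} (hf : ContDiff ℝ ∞ f) (c : ℝ) :
    ContDiff ℝ ∞ (fun x => ∫ t in c..x, f t) := by
  have hd : ∀ x, HasDerivAt (fun x => ∫ t in c..x, f t) (f x) x := fun x =>
    hf.continuous.integral_hasStrictDerivAt c x |>.hasDerivAt
  refine contDiff_infty_iff_deriv.2 ⟨fun x => (hd x).differentiableAt, ?_⟩
  rwa [show deriv (fun x => ∫ t in c..x, f t) = f from funext fun x => (hd x).deriv]

/-- An even smooth step with bounded derivatives, zero near the origin and one far from it. -/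
theorem exists_even_smooth_step :
    ∃ (η : ℝ → ℝ) (C : ℝ), ContDiff ℝ ∞ η ∧ (∀ y, η (-y) = η y) ∧
      (∀ y, 0 ≤ η y) ∧ (∀ y, η y ≤ 1) ∧ (∀ y, |y| ≤ 1 / 2 → η y = 0) ∧
      (∀ y, 1 ≤ |y| → η y = 1) ∧
      (∀ y, |deriv η y| ≤ C) ∧ ∀ y, |deriv (deriv η) y| ≤ C := by
  let b : ContDiffBump (0 : ℝ) := ⟨1 / 2, 1, by norm_num, by norm_num⟩
  have hs : ContDiff ℝ ∞ b := b.contDiff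
  have hs' : ContDiff ℝ ∞ (deriv b) := (contDiff_infty_iff_deriv.1 hs).2
  have hs'' : ContDiff ℝ ∞ (deriv (deriv b)) := (contDiff_infty_iff_deriv.1 hs').2
  obtain ⟨C₁, hC₁⟩ := b.hasCompactSupport.deriv.exists_bound_of_continuous hs'.continuous
  obtain ⟨C₂, hC₂⟩ := b.hasCompactSupport.deriv.deriv.exists_bound_of_continuous hs''.continuous
  have hd : deriv (fun y => 1 - b y) = fun y => -deriv b y := by
    funext y
    simp
  refine ⟨fun y => 1 - b y, max C₁ C₂, contDiff_const.sub hs, fun y => ?_,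
    fun y => sub_nonneg.2 b.le_one, fun y => sub_le_self _ b.nonneg, fun y hy => ?_,
    fun y hy => ?_, fun y => ?_, fun y => ?_⟩
  · simp [b.neg]
  · simp [b.one_of_mem_closedBall (x := y) (by simpa [b] using hy)]
  · simp [b.zero_of_le_dist (x := y) (by simpa [b] using hy)]
  · rw [hd, abs_neg]
    exact (hC₁ y).trans (le_max_left _ _)
  · rw [hd, deriv.fun_neg, abs_neg]
    exact (hC₂ y).trans (le_max_right _ _)

/-- A smooth descent from one to zero between `7 / 20` and `173 / 125` with slope at least `-1`. -/
theorem exists_slow_descent :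
    ∃ ψ : ℝ → ℝ, ContDiff ℝ ∞ ψ ∧ (∀ y ≤ 7 / 20, ψ y = 1) ∧
      (∀ y, 173 / 125 ≤ y → ψ y = 0) ∧ ∀ y, -1 ≤ deriv ψ y ∧ deriv ψ y ≤ 0 := by
  let b : ContDiffBump (0.868 : ℝ) := ⟨0.505, 0.515, by norm_num, by norm_num⟩
  have hs : ContDiff ℝ ∞ b := b.contDiff
  have hint : ∀ x y, IntervalIntegrable b MeasureTheory.volume x y := fun x y =>
    hs.continuous.intervalIntegrable x y
  set I : ℝ := ∫ t in (0 : ℝ)..1.384, b t with hI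
  have hI1 : 1 ≤ I := by
    have h1 : ∫ t in (0.363 : ℝ)..1.373, b t ≤ I :=
      intervalIntegral.integral_mono_interval (by norm_num) (by norm_num) (by norm_num)
        (Filter.Eventually.of_forall fun t => b.nonneg) (hint _ _)
    have h2 : ∫ t in (0.363 : ℝ)..1.373, b t = ∫ t in (0.363 : ℝ)..1.373, (1 : ℝ) := by
      refine intervalIntegral.integral_congr fun t ht => ?_
      rw [Set.uIcc_of_le (by norm_num)] at ht
      refine b.one_of_mem_closedBall ?_
      rw [Metric.mem_closedBall, Real.dist_eq, abs_le]
      constructor <;> norm_num [b] at ht ⊢ <;> linarith [ht.1, ht.2]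
    rw [h2] at h1
    norm_num at h1
    linarith
  have hI0 : 0 < I := by linarith
  have hd : ∀ y, HasDerivAt (fun y => 1 - (∫ t in (0 : ℝ)..y, b t) / I) (-(b y / I)) y := fun y =>
    ((hs.continuous.integral_hasStrictDerivAt 0 y).hasDerivAt.div_const I).const_sub 1
  refine ⟨fun y => 1 - (∫ t in (0 : ℝ)..y, b t) / I,
    contDiff_const.sub ((contDiff_primitive hs 0).div_const I), fun y hy => ?_, fun y hy => ?_,
    fun y => ?_⟩
  · have h0 : ∫ t in (0 : ℝ)..y, b t = ∫ t in (0 : ℝ)..y, (0 : ℝ) := by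
      refine intervalIntegral.integral_congr fun t ht => ?_
      have ht' : t ≤ 7 / 20 := ht.2.trans (max_le (by norm_num) hy)
      refine b.zero_of_le_dist ?_
      rw [Real.dist_eq]
      refine le_trans ?_ (neg_le_abs _)
      norm_num [b]
      linarith
    simp [h0]
  · have h0 : ∫ t in (1.384 : ℝ)..y, b t = ∫ t in (1.384 : ℝ)..y, (0 : ℝ) := by
      refine intervalIntegral.integral_congr fun t ht => ?_
      have ht' : 1.384 ≤ t := (le_min le_rfl (by linarith)).trans ht.1
      refine b.zero_of_le_dist ?_
      rw [Real.dist_eq]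
      refine le_trans ?_ (le_abs_self _)
      norm_num [b] at ht' ⊢
      linarith
    have h1 := intervalIntegral.integral_add_adjacent_intervals (hint 0 1.384) (hint 1.384 y)
    rw [h0, intervalIntegral.integral_zero, add_zero] at h1
    simp only [← h1, ← hI, div_self hI0.ne', sub_self]
  · rw [(hd y).deriv]
    have h1 : b y / I ≤ 1 := (div_le_one hI0).2 (b.le_one.trans hI1)
    have h2 : 0 ≤ b y / I := div_nonneg b.nonneg hI0.le
    constructor <;> linarith

/-- An even cutoff `φ` for which `t * φ' t` stays in `[-1, 0]`. -/
theorem exists_slow_even_cutoff :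
    ∃ φ : ℝ → ℝ, ContDiff ℝ ∞ φ ∧ (∀ t, φ (-t) = φ t) ∧ (∀ t, |t| ≤ 1 / 4 → φ t = 1) ∧
      (∀ t, 1 ≤ |t| → φ t = 0) ∧ (∀ t, 0 ≤ φ t) ∧ (∀ t, φ t ≤ 1) ∧
      ∀ t, -1 ≤ t * deriv φ t ∧ t * deriv φ t ≤ 0 := by
  obtain ⟨ψ, hψ, hψ1, hψ0, hψd⟩ := exists_slow_descent
  have hanti : Antitone ψ :=
    antitone_of_deriv_nonpos (hψ.differentiable (by simp)) fun y => (hψd y).2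
  have hpos : ∀ t : ℝ, 0 < 1 + 16 * t ^ 2 := fun t => by positivity
  have hlog2 := Real.log_two_gt_d9
  have hlog2' := Real.log_two_lt_d9
  refine ⟨fun t => ψ (Real.log (1 + 16 * t ^ 2) / 2), ?_, fun t => by simp, fun t ht => ?_,
    fun t ht => ?_, fun t => ?_, fun t => ?_, fun t => ?_⟩
  · exact hψ.comp ((ContDiff.log (by fun_prop) fun t => (hpos t).ne').div_const 2)
  · have ht2 : t ^ 2 ≤ (1 / 4) ^ 2 := sq_le_sq' (abs_le.1 ht).1 (abs_le.1 ht).2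
    have := Real.log_le_log (hpos t) (show 1 + 16 * t ^ 2 ≤ 2 by linarith)
    exact hψ1 _ (by linarith)
  · have ht2 : 1 ≤ t ^ 2 := by rwa [one_le_sq_iff_one_le_abs]
    have := Real.log_le_log (by norm_num) (show (2 : ℝ) ^ 4 ≤ 1 + 16 * t ^ 2 by linarith)
    rw [Real.log_pow] at this
    push_cast at this
    exact hψ0 _ (by linarith)
  · set y := Real.log (1 + 16 * t ^ 2) / 2
    have := hanti (le_max_left y (173 / 125))
    rwa [hψ0 _ (le_max_right _ _)] at this
  · set y := Real.log (1 + 16 * t ^ 2) / 2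
    have := hanti (min_le_left y (7 / 20))
    rwa [hψ1 _ (min_le_right _ _)] at this
  · have hin : HasDerivAt (fun t : ℝ => Real.log (1 + 16 * t ^ 2) / 2)
        (16 * (2 * t) / (1 + 16 * t ^ 2) / 2) t := by
      have h1 : HasDerivAt (fun t : ℝ => 1 + 16 * t ^ 2) (16 * (2 * t)) t := by
        simpa using ((hasDerivAt_pow 2 t).const_mul 16).const_add 1
      exact (h1.log (hpos t).ne').div_const 2
    have hc := ((hψ.differentiable (by simp)) _).hasDerivAt.comp t hin
    have hc' : deriv (fun t => ψ (Real.log (1 + 16 * t ^ 2) / 2)) t = _ := hc.deriv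
    rw [hc']
    set d := deriv ψ (Real.log (1 + 16 * t ^ 2) / 2)
    have hd : -1 ≤ d ∧ d ≤ 0 := hψd _
    have hr : t * (d * (16 * (2 * t) / (1 + 16 * t ^ 2) / 2))
        = d * (16 * t ^ 2 / (1 + 16 * t ^ 2)) := by ring
    have hr0 : 0 ≤ 16 * t ^ 2 / (1 + 16 * t ^ 2) := by positivity
    have hr1 : 16 * t ^ 2 / (1 + 16 * t ^ 2) ≤ 1 := (div_le_one (hpos t)).2 (by linarith)
    rw [hr]
    constructor <;> nlinarith [hd.1, hd.2]

theorem hasDerivAt_one_sub_cos_pow (k : ℕ) (x : ℝ) :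
    HasDerivAt (fun x => 1 - Real.cos x ^ (k + 1))
      ((k + 1) * Real.cos x ^ k * Real.sin x) x := by
  refine (((Real.hasDerivAt_cos x).fun_pow (k + 1)).const_sub 1).congr_deriv ?_
  push_cast
  simp

theorem hasDerivAt_cos_pow_mul_sin (k : ℕ) (x : ℝ) :
    HasDerivAt (fun x => ((k : ℝ) + 1) * Real.cos x ^ k * Real.sin x)
      ((k + 1) * (Real.cos x ^ (k + 1) - k * Real.cos x ^ (k - 1) * Real.sin x ^ 2)) x := by
  refine ((((Real.hasDerivAt_cos x).fun_pow k).const_mul ((k : ℝ) + 1)).mul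
    (Real.hasDerivAt_sin x)).congr_deriv ?_
  ring

/-- Near the origin `1 - cos ^ (k + 1)` is convex. -/
theorem second_deriv_one_sub_cos_pow_mem (k : ℕ) {x a : ℝ} (hx : |x| ≤ a) (ha : a ≤ 1)
    (hka : (k + 1) * a ^ 2 ≤ 1) :
    0 ≤ Real.cos x ^ (k + 1) - k * Real.cos x ^ (k - 1) * Real.sin x ^ 2 ∧
      Real.cos x ^ (k + 1) - k * Real.cos x ^ (k - 1) * Real.sin x ^ 2 ≤ 1 := by
  have hc : 0 ≤ Real.cos x := Real.cos_nonneg_of_neg_pi_div_two_le_of_le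
    (by linarith [(abs_le.1 hx).1, Real.pi_gt_three])
    (by linarith [(abs_le.1 hx).2, Real.pi_gt_three])
  have hs : Real.sin x ^ 2 ≤ a ^ 2 :=
    (sq_le_sq.2 Real.abs_sin_le_abs).trans (sq_le_sq' (abs_le.1 hx).1 (abs_le.1 hx).2)
  constructor
  · rcases k with _ | j
    · simpa using hc
    · have h1 : 0 ≤ Real.cos x ^ 2 - ((j : ℝ) + 1) * Real.sin x ^ 2 := by
        rw [Real.cos_sq']
        push_cast at hka
        nlinarith [mul_le_mul_of_nonneg_left hs (show (0 : ℝ) ≤ j + 1 + 1 by positivity)]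
      have h2 := mul_nonneg (pow_nonneg hc j) h1
      calc (0 : ℝ) ≤ _ := h2
        _ = _ := by
          push_cast
          ring
  · have h1 : Real.cos x ^ (k + 1) ≤ 1 := pow_le_one₀ hc (Real.cos_le_one x)
    have h2 : 0 ≤ k * Real.cos x ^ (k - 1) * Real.sin x ^ 2 := by positivity
    linarith

/-- A flattening of `1 - cos ^ (k + 1)` to a constant outside `[-a, a]`. -/
theorem exists_flattening_one_sub_cos_pow (k : ℕ) {a : ℝ} (ha : 0 < a) (ha1 : a ≤ 1)
    (hka : (k + 1) * a ^ 2 ≤ 1) :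
    ∃ G : ℝ → ℝ, ContDiff ℝ ∞ G ∧ (∀ x, G (-x) = G x) ∧
      (∀ x, 0 ≤ x → x ≤ a / 4 → G x = 1 - Real.cos x ^ (k + 1)) ∧
      (∀ x, a ≤ x → G x = G a) ∧ (∀ x, 0 ≤ x → 0 ≤ G x) ∧
      (∀ x, 0 ≤ x → G x ≤ (k + 1) * a ^ 2) ∧
      (∀ x, 0 ≤ x → |deriv G x| ≤ (k + 1) * a) ∧
      ∀ x, 0 ≤ x → |deriv (deriv G) x| ≤ k + 1 := by
  obtain ⟨φ, hφ, hφe, hφ1, hφ0, hφn, hφl, hφd⟩ := exists_slow_even_cutoff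
  set w : ℝ → ℝ := fun s => ((k : ℝ) + 1) * Real.cos s ^ k * Real.sin s * φ (s / a) with hw
  have hws : ContDiff ℝ ∞ w := by
    have : ContDiff ℝ ∞ (fun s => φ (s / a)) := hφ.comp (contDiff_id.div_const a)
    have h2 : ContDiff ℝ ∞ (fun s => ((k : ℝ) + 1) * Real.cos s ^ k * Real.sin s) :=
      (contDiff_const.mul (Real.contDiff_cos.pow k)).mul Real.contDiff_sin
    exact h2.mul this
  have hint : ∀ x y, IntervalIntegrable w MeasureTheory.volume x y := fun x y =>
    hws.continuous.intervalIntegrable x y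
  have hd : ∀ x, HasDerivAt (fun x => ∫ t in (0 : ℝ)..x, w t) (w x) x := fun x =>
    hws.continuous.integral_hasStrictDerivAt 0 x |>.hasDerivAt
  have hw0 : ∀ x, a ≤ x → w x = 0 := fun x hx => by
    have : φ (x / a) = 0 := hφ0 _ (((one_le_div ha).2 hx).trans (le_abs_self _))
    simp [hw, this]
  have hwb : ∀ x, 0 ≤ x → 0 ≤ w x ∧ w x ≤ (k + 1) * a := fun x hx => by
    rcases le_total a x with h | h
    · rw [hw0 x h]
      exact ⟨le_rfl, by positivity⟩
    · have hc : 0 ≤ Real.cos x := Real.cos_nonneg_of_neg_pi_div_two_le_of_le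
        (by linarith [Real.pi_gt_three]) (by linarith [Real.pi_gt_three])
      have hs : 0 ≤ Real.sin x :=
        Real.sin_nonneg_of_nonneg_of_le_pi hx (by linarith [Real.pi_gt_three])
      have hsa : Real.sin x ≤ a := (Real.sin_le hx).trans h
      have hφx := hφn (x / a)
      refine ⟨by positivity, ?_⟩
      calc w x = (k + 1) * (Real.cos x ^ k * Real.sin x * φ (x / a)) := by simp only [hw]; ring
        _ ≤ (k + 1) * (1 * a * 1) := by
          gcongr
          · exact pow_le_one₀ hc (Real.cos_le_one x)
          · exact hφl _
        _ = _ := by ring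
  have hderiv : deriv (fun x => ∫ t in (0 : ℝ)..x, w t) = w := funext fun x => (hd x).deriv
  have hconst : ∀ x, a ≤ x → (∫ t in (0 : ℝ)..x, w t) = ∫ t in (0 : ℝ)..a, w t := fun x hx => by
    rw [← intervalIntegral.integral_add_adjacent_intervals (hint 0 a) (hint a x)]
    have : ∫ t in a..x, w t = ∫ t in a..x, (0 : ℝ) := by
      refine intervalIntegral.integral_congr fun t ht => ?_
      rw [Set.uIcc_of_le hx] at ht
      exact hw0 t ht.1
    simp [this]
  have hle : ∀ x, 0 ≤ x → x ≤ a → ∫ t in (0 : ℝ)..x, w t ≤ (k + 1) * a ^ 2 := fun x hx hxa => by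
    have h1 : ∫ t in (0 : ℝ)..x, w t ≤ ∫ t in (0 : ℝ)..x, ((k : ℝ) + 1) * a :=
      intervalIntegral.integral_mono_on hx (hint _ _) (by simp) fun t ht => (hwb t ht.1).2
    refine h1.trans ?_
    rw [intervalIntegral.integral_const, smul_eq_mul, sub_zero]
    have : 0 ≤ ((k : ℝ) + 1) * a := by positivity
    nlinarith
  refine ⟨fun x => ∫ t in (0 : ℝ)..x, w t, contDiff_primitive hws 0, fun x => ?_,
    fun x hx hxa => ?_, hconst, fun x hx => ?_, fun x hx => ?_, fun x hx => ?_, fun x hx => ?_⟩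
  · have h1 : ∀ t, w (-t) = -w t := fun t => by simp [hw, neg_div, hφe]
    have h2 := intervalIntegral.integral_comp_neg (a := 0) (b := x) w
    simp only [h1, intervalIntegral.integral_neg, neg_zero] at h2
    simp only [intervalIntegral.integral_symm (-x) 0, ← h2, neg_neg]
  · have h1 : ∫ t in (0 : ℝ)..x, w t
        = ∫ t in (0 : ℝ)..x, ((k : ℝ) + 1) * Real.cos t ^ k * Real.sin t := by
      refine intervalIntegral.integral_congr fun t ht => ?_
      rw [Set.uIcc_of_le hx] at ht
      have : φ (t / a) = 1 := by
        refine hφ1 _ ?_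
        rw [abs_of_nonneg (div_nonneg ht.1 ha.le), div_le_iff₀ ha]
        linarith [ht.2]
      simp [hw, this]
    simp only [h1]
    rw [intervalIntegral.integral_eq_sub_of_hasDerivAt
      (fun t _ => hasDerivAt_one_sub_cos_pow k t)
      (Continuous.intervalIntegrable (by fun_prop) _ _)]
    simp
  · exact intervalIntegral.integral_nonneg hx fun t ht => (hwb t ht.1).1
  · rcases le_total x a with h | h
    · exact hle x hx h
    · simp only [hconst x h]
      exact hle a ha.le le_rfl
  · rw [hderiv, abs_of_nonneg (hwb x hx).1]
    exact (hwb x hx).2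
  · rw [hderiv]
    have hφc : HasDerivAt (fun s => φ (s / a)) (deriv φ (x / a) * (1 / a)) x :=
      ((hφ.differentiable (by simp)) _).hasDerivAt.comp x ((hasDerivAt_id x).div_const a)
    have hwd : deriv w x = _ := ((hasDerivAt_cos_pow_mul_sin k x).mul hφc).deriv
    rcases le_or_gt x a with h | h
    · rw [hwd]
      set c := Real.cos x ^ (k + 1) - k * Real.cos x ^ (k - 1) * Real.sin x ^ 2
      obtain ⟨hc0, hc1⟩ : 0 ≤ c ∧ c ≤ 1 :=
        second_deriv_one_sub_cos_pow_mem k (by rwa [abs_of_nonneg hx]) ha1 hka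
      have hcos : 0 ≤ Real.cos x := Real.cos_nonneg_of_neg_pi_div_two_le_of_le
        (by linarith [Real.pi_gt_three]) (by linarith [Real.pi_gt_three])
      have hs : 0 ≤ Real.sin x :=
        Real.sin_nonneg_of_nonneg_of_le_pi hx (by linarith [Real.pi_gt_three])
      set p := φ (x / a)
      have hp0 : 0 ≤ p := hφn _
      have hp1 : p ≤ 1 := hφl _
      have hcp0 : 0 ≤ c * p := mul_nonneg hc0 hp0
      have hcp1 : c * p ≤ 1 := mul_le_one₀ hc1 hp0 hp1
      obtain ⟨hl, hu⟩ := hφd (x / a)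
      have hq : -1 ≤ Real.cos x ^ k * Real.sin x * (deriv φ (x / a) * (1 / a)) ∧
          Real.cos x ^ k * Real.sin x * (deriv φ (x / a) * (1 / a)) ≤ 0 := by
        rcases hx.eq_or_lt with rfl | hx0
        · simp
        · have hD : deriv φ (x / a) ≤ 0 := by
            by_contra! hpos
            exact absurd hu (not_le.2 (mul_pos (div_pos hx0 ha) hpos))
          have hD' : deriv φ (x / a) * (1 / a) ≤ 0 :=
            mul_nonpos_of_nonpos_of_nonneg hD (by positivity)
          have hcs0 : 0 ≤ Real.cos x ^ k * Real.sin x := by positivity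
          have hcs : Real.cos x ^ k * Real.sin x ≤ x :=
            (mul_le_of_le_one_left hs (pow_le_one₀ hcos (Real.cos_le_one x))).trans
              (Real.sin_le hx)
          refine ⟨?_, mul_nonpos_of_nonneg_of_nonpos hcs0 hD'⟩
          calc (-1 : ℝ) ≤ x / a * deriv φ (x / a) := hl
            _ = x * (deriv φ (x / a) * (1 / a)) := by ring
            _ ≤ _ := mul_le_mul_of_nonpos_right hcs hD'
      set q := Real.cos x ^ k * Real.sin x * (deriv φ (x / a) * (1 / a)) with hqdef
      have heq : ((k : ℝ) + 1) * c * p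
          + ((k : ℝ) + 1) * Real.cos x ^ k * Real.sin x * (deriv φ (x / a) * (1 / a))
          = (k + 1) * (c * p + q) := by rw [hqdef]; ring
      rw [heq, abs_mul, abs_of_pos (by positivity : (0 : ℝ) < k + 1)]
      refine mul_le_of_le_one_right (by positivity) (abs_le.2 ⟨?_, ?_⟩) <;> linarith [hq.1, hq.2]
    · have : w =ᶠ[nhds x] fun _ => 0 := by
        filter_upwards [lt_mem_nhds h] with y hy using hw0 y hy.le
      rw [this.deriv_eq, deriv_const, abs_zero]
      positivity


open Real

/-- (Construction of `P_{m,n,α}`.) For every `m ≥ 1` and `α ∈ (0,1/4]`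
there is `N` such that for all `n ≥ N` there is a `C^∞` function `P : ℝ → ℝ`, symmetric
about `π/2` on `[0,π]`, vanishing on `[π/2 + 1/(mn), π]`, equal to `1 − sin^m θ` on
`[π/2, π/2 + α/(mn)²]`, with `0 ≤ P ≤ 2m/(mn)³`, `|P'| ≤ 2m/(mn)²` and
`−m(1+5α) ≤ P'' ≤ m(1+α)` on `[π/2, π]`. -/
theorem construction_P_mna
    (m : ℕ) (hm : 1 ≤ m) (α : ℝ) (hα : α ∈ Set.Ioc (0 : ℝ) (1 / 4)) :
    ∃ N : ℕ, ∀ n : ℕ, N ≤ n →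
    ∃ P : ℝ → ℝ, ContDiff ℝ (⊤ : ℕ∞) P ∧
      (∀ θ ∈ Set.Icc (0 : ℝ) π, P (π - θ) = P θ) ∧
      (∀ θ ∈ Set.Icc (π / 2 + 1 / ((m : ℝ) * n)) π, P θ = 0) ∧
      (∀ θ ∈ Set.Icc (π / 2) (π / 2 + α / ((m : ℝ) * n) ^ 2),
        P θ = 1 - Real.sin θ ^ m) ∧
      (∀ θ ∈ Set.Icc (π / 2) π,
        (0 ≤ P θ ∧ P θ ≤ 2 * (m : ℝ) / ((m : ℝ) * n) ^ 3) ∧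
        |deriv P θ| ≤ 2 * (m : ℝ) / ((m : ℝ) * n) ^ 2) ∧
      (∀ θ ∈ Set.Icc (π / 2) π,
        -(m : ℝ) * (1 + 5 * α) ≤ deriv (deriv P) θ ∧
          deriv (deriv P) θ ≤ (m : ℝ) * (1 + α)) := by
  obtain ⟨k, rfl⟩ : ∃ k, m = k + 1 := ⟨m - 1, by omega⟩
  obtain ⟨hα0, hα1⟩ := hα
  obtain ⟨η, C, hη, hηe, hηn, hηl, hη0, hη1, hηd, hηdd⟩ := exists_even_smooth_step
  have hC : 0 ≤ C := (abs_nonneg _).trans (hηd 0)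
  refine ⟨⌈C / α⌉₊ + 2, fun n hn => ?_⟩
  have hnC : C / α ≤ n :=
    (Nat.le_ceil _).trans (by exact_mod_cast (Nat.le_add_right _ 2).trans hn)
  have hn2 : (2 : ℝ) ≤ n := by exact_mod_cast (Nat.le_add_left 2 _).trans hn
  have hk1 : (0 : ℝ) < k + 1 := by positivity
  push_cast
  set M : ℝ := (k : ℝ) + 1 with hM
  have hM1 : 1 ≤ M := by simp [hM]
  set h : ℝ := 1 / (M * n) with hh
  have hn0 : (0 : ℝ) < n := by linarith
  have hh0 : 0 < h := by positivity
  have hnh : M * n * h = 1 := by rw [hh]; field_simp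
  have hMh : M * h ≤ 1 / 2 := by nlinarith [mul_pos hk1 hh0]
  have hh2 : h ≤ 1 / 2 := by nlinarith
  have hCh : C * h ≤ α := by
    have h1 : C ≤ n * α := (div_le_iff₀ hα0).1 hnC
    have h2 : C ≤ M * n * α := by nlinarith [mul_pos hn0 hα0]
    calc C * h ≤ M * n * α * h := by gcongr
      _ = (M * n * h) * α := by ring
      _ = α := by rw [hnh, one_mul]
  have hdiv : ∀ (c : ℝ) (j : ℕ), c / (M * n) ^ j = c * h ^ j := fun c j => by
    rw [hh, one_div, inv_pow, div_eq_mul_inv]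
  simp only [hdiv]
  have hhsq : h ^ 2 ≤ h / 2 := by nlinarith
  obtain ⟨G, hG, hGe, hGc, hGconst, hGn, hGl, hGd, hGdd⟩ :=
    exists_flattening_one_sub_cos_pow k (a := h ^ 2) (by positivity) (by linarith)
      (by nlinarith [mul_le_mul_of_nonneg_left hhsq hh0.le, mul_pos hh0 hh0])
  simp only [← hM] at hGl hGd hGdd
  set g : ℝ := G (h ^ 2) with hg
  have hg0 : 0 ≤ g := hGn _ (by positivity)
  have hgl : g ≤ M * (h ^ 2) ^ 2 := hGl _ (by positivity)
  have hG1 : ContDiff ℝ ∞ (deriv G) := (contDiff_infty_iff_deriv.1 hG).2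
  have hη1' : ContDiff ℝ ∞ (deriv η) := (contDiff_infty_iff_deriv.1 hη).2
  have hsub : ∀ θ : ℝ, HasDerivAt (fun θ : ℝ => θ - π / 2) 1 θ := fun θ =>
    (hasDerivAt_id θ).sub_const _
  have hP1 : deriv (fun θ => G (θ - π / 2) - g * η ((θ - π / 2) / h))
      = fun θ => deriv G (θ - π / 2) - g * (deriv η ((θ - π / 2) / h) * (1 / h)) :=
    funext fun θ => by
      have h1 := ((hG.differentiable (by simp)) _).hasDerivAt.comp θ (hsub θ)
      have h2 := ((hη.differentiable (by simp)) _).hasDerivAt.comp θ ((hsub θ).div_const h)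
      rw [mul_one] at h1
      exact (h1.sub (h2.const_mul g)).deriv
  have hP2 : deriv (fun θ => deriv G (θ - π / 2) - g * (deriv η ((θ - π / 2) / h) * (1 / h)))
      = fun θ => deriv (deriv G) (θ - π / 2)
        - g * (deriv (deriv η) ((θ - π / 2) / h) * (1 / h) * (1 / h)) :=
    funext fun θ => by
      have h1 := ((hG1.differentiable (by simp)) _).hasDerivAt.comp θ (hsub θ)
      have h2 := ((hη1'.differentiable (by simp)) _).hasDerivAt.comp θ ((hsub θ).div_const h)
      rw [mul_one] at h1
      exact (h1.sub ((h2.mul_const (1 / h)).const_mul g)).deriv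
  refine ⟨fun θ => G (θ - π / 2) - g * η ((θ - π / 2) / h), ?_, fun θ _ => ?_, fun θ hθ => ?_,
    fun θ hθ => ?_, fun θ hθ => ⟨?_, ?_⟩, fun θ hθ => ?_⟩
  · exact (hG.comp (contDiff_id.sub contDiff_const)).sub
      (contDiff_const.mul (hη.comp ((contDiff_id.sub contDiff_const).div_const h)))
  · have h1 : π - θ - π / 2 = -(θ - π / 2) := by ring
    simp only [h1, neg_div, hGe, hηe]
  · have hx : h ≤ θ - π / 2 := by linarith [hθ.1]
    have h1 : η ((θ - π / 2) / h) = 1 :=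
      hη1 _ (((one_le_div hh0).2 hx).trans (le_abs_self _))
    simp only [h1, hGconst _ (show h ^ 2 ≤ θ - π / 2 by linarith)]
    ring
  · have hx0 : 0 ≤ θ - π / 2 := by linarith [hθ.1]
    have hx1 : θ - π / 2 ≤ h ^ 2 / 4 := by nlinarith [hθ.2, sq_nonneg h]
    have h1 : η ((θ - π / 2) / h) = 0 := by
      refine hη0 _ ?_
      rw [abs_of_nonneg (div_nonneg hx0 hh0.le), div_le_iff₀ hh0]
      linarith
    simp only [h1, hGc _ hx0 hx1, Real.cos_sub_pi_div_two]
    ring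
  · have hx0 : 0 ≤ θ - π / 2 := by linarith [hθ.1]
    have hgη := mul_nonneg hg0 (hηn ((θ - π / 2) / h))
    constructor
    · rcases le_total (h ^ 2) (θ - π / 2) with hx | hx
      · simp only [hGconst _ hx]
        nlinarith [hηl ((θ - π / 2) / h)]
      · have h1 : η ((θ - π / 2) / h) = 0 := by
          refine hη0 _ ?_
          rw [abs_of_nonneg (div_nonneg hx0 hh0.le), div_le_iff₀ hh0]
          linarith
        simpa only [h1, mul_zero, sub_zero] using hGn _ hx0
    · have h1 := hGl _ hx0
      have h2 : M * (h ^ 2) ^ 2 ≤ 2 * M * h ^ 3 := by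
        have h3 : 0 ≤ M * h ^ 3 := by positivity
        nlinarith
      linarith
  · have hx0 : 0 ≤ θ - π / 2 := by linarith [hθ.1]
    rw [hP1]
    have h1 := hGd _ hx0
    have h2 : |g * (deriv η ((θ - π / 2) / h) * (1 / h))| ≤ M * h ^ 2 := by
      rw [abs_mul, abs_mul, abs_of_nonneg hg0, abs_of_pos (one_div_pos.2 hh0)]
      calc g * (|deriv η ((θ - π / 2) / h)| * (1 / h))
          ≤ M * (h ^ 2) ^ 2 * (C * (1 / h)) := by gcongr; exact hηd _
        _ = M * h ^ 2 * ((C * h) * 1) := by field_simp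
        _ ≤ M * h ^ 2 * 1 := by gcongr; linarith
        _ = M * h ^ 2 := mul_one _
    exact (abs_sub _ _).trans (by linarith)
  · have hx0 : 0 ≤ θ - π / 2 := by linarith [hθ.1]
    rw [hP1, hP2]
    have h1 := abs_le.1 (hGdd _ hx0)
    have h2 : |g * (deriv (deriv η) ((θ - π / 2) / h) * (1 / h) * (1 / h))| ≤ M * α := by
      rw [abs_mul, abs_mul, abs_mul, abs_of_nonneg hg0, abs_of_pos (one_div_pos.2 hh0)]
      calc g * (|deriv (deriv η) ((θ - π / 2) / h)| * (1 / h) * (1 / h))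
          ≤ M * (h ^ 2) ^ 2 * (C * (1 / h) * (1 / h)) := by gcongr; exact hηdd _
        _ = M * ((C * h) * h) := by field_simp
        _ ≤ M * (α * 1) := by gcongr; linarith
        _ = M * α := by ring
    have h3 := abs_le.1 h2
    have h4 : 0 ≤ M * α := by positivity
    constructor <;> linarith [h1.1, h1.2, h3.1, h3.2]
end

section
/- There exists M > 0 such that for every integer m ≥ M there exist infinitely differentiable functions T : ℝ → ℝ and Q : ℝ → ℝ with the following properties: (1) T(θ) = sin^m(θ) and Q(θ) = 1 for all θ ∉ (π/2 − 1/m, π/2 + 1/m); (2) 1 − 2/m ≤ Q(θ) ≤ 1 + 2/m for all θ (in particular Q > 0); (3) sin²(θ)·T''(θ) + sin(θ)·cos(θ)·T'(θ) + (m(m+1)·Q(θ)·sin²(θ) − m²)·T(θ) = 0 for all θ ∈ (0, π); (4) the set {θ ∈ (0, π) | T(θ) > 1} has infinitely many connected components. (In spherical coordinates, Φ_m(θ,φ) = T(θ)cos(mφ) is then a smooth eigenfunction, with eigenvalue m(m+1), of the Laplace–Beltrami operator of the conformal metric g_m = Q(θ)·g₀ on S², with 1 − 2/m ≤ Q ≤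 1 + 2/m, whose super-level set {Φ_m > 1} has infinitely many connected components.) -/
open Real

lemma exists_abs_iterated_deriv_le {f : ℝ → ℝ} (hf : ContDiff ℝ (⊤ : ℕ∞) f)
    (hc : HasCompactSupport f) :
    ∃ C, 0 < C ∧ ∀ x, |f x| ≤ C ∧ |deriv f x| ≤ C ∧ |deriv (deriv f) x| ≤ C := by
  have h1 : ContDiff ℝ (⊤ : ℕ∞) (deriv f) := (contDiff_infty_iff_deriv.1 hf).2
  have h2 : ContDiff ℝ (⊤ : ℕ∞) (deriv (deriv f)) := (contDiff_infty_iff_deriv.1 h1).2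
  obtain ⟨C0, hC0⟩ := hc.exists_bound_of_continuous hf.continuous
  obtain ⟨C1, hC1⟩ := hc.deriv.exists_bound_of_continuous h1.continuous
  obtain ⟨C2, hC2⟩ := hc.deriv.deriv.exists_bound_of_continuous h2.continuous
  refine ⟨|C0| + |C1| + |C2| + 1, by positivity, fun x => ⟨?_, ?_, ?_⟩⟩
  · linarith [hC0 x, Real.norm_eq_abs (f x), le_abs_self C0, abs_nonneg C1, abs_nonneg C2]
  · linarith [hC1 x, Real.norm_eq_abs (deriv f x), le_abs_self C1, abs_nonneg C0, abs_nonneg C2]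
  · linarith [hC2 x, Real.norm_eq_abs (deriv (deriv f) x), le_abs_self C2, abs_nonneg C1,
      abs_nonneg C0]

/-- A bounded open set is the positivity set of a nonnegative smooth function which is
arbitrarily small in `C²`. -/
lemma IsOpen.exists_contDiff_small_pos_iff {U : Set ℝ} (hU : IsOpen U)
    (hb : Bornology.IsBounded U) {ε : ℝ} (hε : 0 < ε) :
    ∃ f : ℝ → ℝ, ContDiff ℝ (⊤ : ℕ∞) f ∧ (∀ x, 0 ≤ f x) ∧ (∀ x, 0 < f x ↔ x ∈ U) ∧
      ∀ x, |f x| ≤ ε ∧ |deriv f x| ≤ ε ∧ |deriv (deriv f) x| ≤ ε := by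
  obtain ⟨f, hfU, hf, hfr⟩ := hU.exists_contDiff_support_eq (n := ⊤)
  have hf0 : ∀ x, 0 ≤ f x := fun x => (hfr ⟨x, rfl⟩).1
  have hc : HasCompactSupport f := by
    rw [HasCompactSupport, tsupport, hfU]
    exact hb.isCompact_closure
  obtain ⟨C, hC, hfC⟩ := exists_abs_iterated_deriv_le hf hc
  have hd : deriv (fun x => ε / C * f x) = fun x => ε / C * deriv f x := by
    ext x; exact deriv_const_mul_field _
  have hdd : deriv (fun x => ε / C * deriv f x) = fun x => ε / C * deriv (deriv f) x := by
    ext x; exact deriv_const_mul_field _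
  have key : ∀ a : ℝ, |a| ≤ C → |ε / C * a| ≤ ε := fun a ha => by
    rw [abs_mul, abs_of_pos (div_pos hε hC)]
    calc ε / C * |a| ≤ ε / C * C := by gcongr
      _ = ε := by field_simp
  refine ⟨fun x => ε / C * f x, contDiff_const.mul hf, fun x => mul_nonneg (by positivity) (hf0 x),
    fun x => ?_, fun x => ?_⟩
  · rw [← hfU, Function.mem_support, mul_pos_iff_of_pos_left (div_pos hε hC)]
    exact ⟨fun h => h.ne', fun h => (hf0 x).lt_of_ne' h⟩
  · rw [hd, hdd]
    exact ⟨key _ (hfC x).1, key _ (hfC x).2.1, key _ (hfC x).2.2⟩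

lemma Real.smoothTransition.exists_abs_deriv_le :
    ∃ C, 0 < C ∧ ∀ x, |deriv smoothTransition x| ≤ C ∧
      |deriv (deriv smoothTransition) x| ≤ C := by
  have h : ContDiff ℝ (⊤ : ℕ∞) smoothTransition := smoothTransition.contDiff
  have h1 : ContDiff ℝ (⊤ : ℕ∞) (deriv smoothTransition) := (contDiff_infty_iff_deriv.1 h).2
  have hc : HasCompactSupport (deriv smoothTransition) := by
    refine HasCompactSupport.intro (isCompact_Icc (a := (0 : ℝ)) (b := 1)) fun x hx => ?_
    rcases lt_or_ge x 0 with h0 | h0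
    · have : smoothTransition =ᶠ[nhds x] fun _ => 0 := by
        filter_upwards [Iio_mem_nhds h0] with y hy using smoothTransition.zero_of_nonpos hy.le
      rw [this.deriv_eq, deriv_const]
    · have h2 : 1 < x := by
        by_contra hc
        exact hx ⟨h0, not_lt.1 hc⟩
      have : smoothTransition =ᶠ[nhds x] fun _ => 1 := by
        filter_upwards [Ioi_mem_nhds h2] with y hy using smoothTransition.one_of_one_le hy.le
      rw [this.deriv_eq, deriv_const]
  obtain ⟨C, hC, hb⟩ := exists_abs_iterated_deriv_le h1 hc
  exact ⟨C, hC, fun x => ⟨(hb x).1, (hb x).2.1⟩⟩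

/-- Logarithmic cutoff: the scale-invariant quantities `x χ'` and `x² χ''` can be made
arbitrarily small. -/
lemma exists_log_cutoff {δ ε : ℝ} (hδ : 0 < δ) (hε : 0 < ε) :
    ∃ χ : ℝ → ℝ, ∃ κ, 0 < κ ∧ ContDiff ℝ (⊤ : ℕ∞) χ ∧ (∀ x, 0 ≤ χ x ∧ χ x ≤ 1) ∧
      (∀ x, |x| ≤ κ → χ x = 1) ∧ (∀ x, δ ≤ |x| → χ x = 0) ∧
      ∀ x, |x| * |deriv χ x| ≤ ε ∧ x ^ 2 * |deriv (deriv χ) x| ≤ ε := by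
  obtain ⟨C, hC, hσ⟩ := smoothTransition.exists_abs_deriv_le
  obtain ⟨B, hB, hB1, hBε⟩ : ∃ B : ℝ, 0 < B ∧ B ≤ 1 ∧ 6 * B * C ≤ ε := by
    refine ⟨min 1 (ε / (6 * C)), by positivity, min_le_left _ _, ?_⟩
    calc 6 * min 1 (ε / (6 * C)) * C ≤ 6 * (ε / (6 * C)) * C := by
          gcongr; exact min_le_right _ _
      _ = ε := by field_simp
  set k : ℝ := δ * exp (-(1 / (2 * B))) / 2 with hk
  have hk0 : 0 < k := by positivity
  have hpos : ∀ x : ℝ, 0 < x ^ 2 + k ^ 2 := fun x => by positivity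
  set u : ℝ → ℝ := fun x => B * (log (δ ^ 2) - log (x ^ 2 + k ^ 2)) with hu
  have hsm : ContDiff ℝ (⊤ : ℕ∞) smoothTransition := smoothTransition.contDiff
  have hsm1 : ContDiff ℝ (⊤ : ℕ∞) (deriv smoothTransition) := (contDiff_infty_iff_deriv.1 hsm).2
  have hus : ContDiff ℝ (⊤ : ℕ∞) u := by
    refine contDiff_const.mul (contDiff_const.sub (ContDiff.log (by fun_prop) fun x => (hpos x).ne'))
  have hud : ∀ x, HasDerivAt u (-B * (2 * x / (x ^ 2 + k ^ 2))) x := fun x => by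
    have h1 : HasDerivAt (fun x : ℝ => x ^ 2 + k ^ 2) (2 * x) x := by
      simpa using (hasDerivAt_pow 2 x).add_const (k ^ 2)
    exact (((h1.log (hpos x).ne').const_sub (log (δ ^ 2))).const_mul B).congr_deriv (by ring)
  have hudd : ∀ x, HasDerivAt (fun x : ℝ => -B * (2 * x / (x ^ 2 + k ^ 2)))
      (-B * ((2 * k ^ 2 - 2 * x ^ 2) / (x ^ 2 + k ^ 2) ^ 2)) x := fun x => by
    have h1 : HasDerivAt (fun x : ℝ => x ^ 2 + k ^ 2) (2 * x) x := by
      simpa using (hasDerivAt_pow 2 x).add_const (k ^ 2)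
    have h2 : HasDerivAt (fun x : ℝ => 2 * x) 2 x := by
      simpa using (hasDerivAt_id x).const_mul (2 : ℝ)
    exact ((h2.div h1 (hpos x).ne').const_mul (-B)).congr_deriv (by ring)
  have hd : deriv (fun x => smoothTransition (u x)) =
      fun x => deriv smoothTransition (u x) * (-B * (2 * x / (x ^ 2 + k ^ 2))) := by
    ext x
    exact ((hsm.differentiable (by simp) (u x)).hasDerivAt.comp x (hud x)).deriv
  have hdd : deriv (fun x => deriv smoothTransition (u x) * (-B * (2 * x / (x ^ 2 + k ^ 2)))) =
      fun x => deriv (deriv smoothTransition) (u x) * (-B * (2 * x / (x ^ 2 + k ^ 2))) *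
        (-B * (2 * x / (x ^ 2 + k ^ 2))) + deriv smoothTransition (u x) *
          (-B * ((2 * k ^ 2 - 2 * x ^ 2) / (x ^ 2 + k ^ 2) ^ 2)) := by
    ext x
    exact (((hsm1.differentiable (by simp) (u x)).hasDerivAt.comp x (hud x)).mul (hudd x)).deriv
  have hfrac : ∀ x : ℝ, 0 ≤ x ^ 2 / (x ^ 2 + k ^ 2) ∧ x ^ 2 / (x ^ 2 + k ^ 2) ≤ 1 := fun x =>
    ⟨by positivity, by rw [div_le_one (hpos x)]; nlinarith⟩
  refine ⟨fun x => smoothTransition (u x), k, hk0, hsm.comp hus,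
    fun x => ⟨smoothTransition.nonneg _, smoothTransition.le_one _⟩, fun x hx => ?_, fun x hx => ?_,
    fun x => ⟨?_, ?_⟩⟩
  · apply smoothTransition.one_of_one_le
    have h1 : x ^ 2 + k ^ 2 ≤ δ ^ 2 * exp (-(1 / B)) := by
      have h3 : exp (-(1 / B)) = exp (-(1 / (2 * B))) ^ 2 := by
        rw [← exp_nat_mul]; congr 1; field_simp; norm_num
      have h2 : x ^ 2 ≤ k ^ 2 := sq_le_sq.2 (by rwa [abs_of_pos hk0])
      have h4 : δ ^ 2 * exp (-(1 / B)) = 4 * k ^ 2 := by rw [h3, hk]; ring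
      nlinarith [sq_nonneg k]
    have h2 := log_le_log (hpos x) h1
    rw [log_mul (by positivity) (by positivity), log_exp] at h2
    calc (1 : ℝ) = B * (1 / B) := by field_simp
      _ ≤ u x := mul_le_mul_of_nonneg_left (by linarith) hB.le
  · apply smoothTransition.zero_of_nonpos
    have h1 : δ ^ 2 ≤ x ^ 2 + k ^ 2 := by
      nlinarith [sq_abs x, sq_nonneg k, abs_nonneg x]
    have h2 := log_le_log (by positivity) h1
    exact mul_nonpos_of_nonneg_of_nonpos hB.le (by linarith)
  · rw [hd]
    have e : |x| * |deriv smoothTransition (u x) * (-B * (2 * x / (x ^ 2 + k ^ 2)))| =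
        2 * B * |deriv smoothTransition (u x)| * (x ^ 2 / (x ^ 2 + k ^ 2)) := by
      rw [← sq_abs x]
      simp only [abs_mul, abs_div, abs_neg, abs_of_pos hB, abs_two, sq_abs, abs_of_pos (hpos x)]
      rw [← sq_abs x]; ring
    dsimp only
    rw [e]
    calc 2 * B * |deriv smoothTransition (u x)| * (x ^ 2 / (x ^ 2 + k ^ 2)) ≤ 2 * B * C * 1 := by
          gcongr
          exacts [(hσ _).1, (hfrac x).2]
      _ ≤ ε := by nlinarith [mul_pos hB hC]
  · rw [hd, hdd]
    dsimp only
    set s := x ^ 2 / (x ^ 2 + k ^ 2) with hs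
    have hs0 := (hfrac x).1
    have hs1 := (hfrac x).2
    rw [← hs] at hs0 hs1
    have e : x ^ 2 * |deriv (deriv smoothTransition) (u x) * (-B * (2 * x / (x ^ 2 + k ^ 2))) *
        (-B * (2 * x / (x ^ 2 + k ^ 2))) + deriv smoothTransition (u x) *
          (-B * ((2 * k ^ 2 - 2 * x ^ 2) / (x ^ 2 + k ^ 2) ^ 2))| =
        |deriv (deriv smoothTransition) (u x) * (4 * B ^ 2 * s ^ 2) +
          deriv smoothTransition (u x) * (-(2 * B * (s * (1 - 2 * s))))| := by
      rw [← abs_of_nonneg (sq_nonneg x), ← abs_mul, abs_of_nonneg (sq_nonneg x)]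
      congr 1
      have := (hpos x).ne'
      rw [hs]; field_simp; ring
    rw [e]
    have h1 : |4 * B ^ 2 * s ^ 2| ≤ 4 * B := by
      rw [abs_of_nonneg (by positivity)]
      have : s ^ 2 ≤ 1 := by nlinarith
      have : B ^ 2 ≤ B := by nlinarith
      nlinarith [sq_nonneg B]
    have h2 : |-(2 * B * (s * (1 - 2 * s)))| ≤ 2 * B := by
      rw [abs_neg, abs_mul, abs_of_pos (by positivity : 0 < 2 * B)]
      have : |s * (1 - 2 * s)| ≤ 1 := by rw [abs_le]; constructor <;> nlinarith
      nlinarith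
    calc _ ≤ _ := abs_add_le _ _
      _ ≤ C * (4 * B) + C * (2 * B) := by
        rw [abs_mul (deriv (deriv smoothTransition) (u x)), abs_mul (deriv smoothTransition (u x))]
        gcongr
        exacts [(hσ _).2, (hσ _).1]
      _ ≤ ε := by linarith

/-- The points of `(0, d)` whose inverse is not an integer. -/
def invNonintegers (d : ℝ) : Set ℝ :=
  Set.Ioo 0 d ∩ (fun x : ℝ => x⁻¹) ⁻¹' (Set.range ((↑) : ℤ → ℝ))ᶜ

lemma isOpen_invNonintegers (d : ℝ) : IsOpen (invNonintegers d) :=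
  ContinuousOn.isOpen_inter_preimage (continuousOn_id.inv₀ fun _ hx => hx.1.ne') isOpen_Ioo
    Int.isClosedEmbedding_coe_real.isClosed_range.isOpen_compl

lemma isBounded_invNonintegers (d : ℝ) : Bornology.IsBounded (invNonintegers d) :=
  (Metric.isBounded_Ioo 0 d).subset Set.inter_subset_left

lemma Int.continuousAt_floor_of_notMem_range {y : ℝ} (hy : y ∉ Set.range ((↑) : ℤ → ℝ)) :
    ContinuousAt (fun z : ℝ => ⌊z⌋) y := by
  have h1 : (⌊y⌋ : ℝ) < y := lt_of_le_of_ne (Int.floor_le y) fun h => hy ⟨_, h⟩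
  refine continuousAt_const.congr (f := fun _ => ⌊y⌋) ?_
  filter_upwards [Ioo_mem_nhds h1 (Int.lt_floor_add_one y)] with z hz
  exact (Int.floor_eq_iff.2 ⟨hz.1.le, hz.2⟩).symm

/-- A space that is a translate of `invNonintegers d` has infinitely many components. -/
lemma infinite_connectedComponents_of_iff {p : ℝ → Prop} {a d : ℝ} (hd : 0 < d)
    (hp : ∀ x, p x ↔ x - a ∈ invNonintegers d) :
    Infinite (ConnectedComponents {x : ℝ // p x}) := by
  have hc : Continuous fun x : {x : ℝ // p x} => ⌊(x.1 - a)⁻¹⌋ := by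
    refine continuous_iff_continuousAt.2 fun x => ?_
    have hx := (hp x.1).1 x.2
    have h1 : ContinuousAt (fun x : {x : ℝ // p x} => (x.1 - a)⁻¹) x :=
      ContinuousAt.inv₀ (by fun_prop) hx.1.1.ne'
    exact ContinuousAt.comp (f := fun x : {x : ℝ // p x} => (x.1 - a)⁻¹)
      (Int.continuousAt_floor_of_notMem_range hx.2) h1
  obtain ⟨N, hN⟩ := exists_nat_gt d⁻¹
  have hN0 : (0 : ℝ) < N := (inv_pos.2 hd).trans hN
  have hmem : ∀ n : ℕ, p (a + ((N : ℝ) + n + 1 / 2)⁻¹) := fun n => by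
    rw [hp, add_sub_cancel_left]
    refine ⟨⟨by positivity, inv_lt_of_inv_lt₀ hd ?_⟩, ?_⟩
    · linarith [(Nat.cast_nonneg n : (0 : ℝ) ≤ n)]
    · rintro ⟨z, hz⟩
      simp only [inv_inv] at hz
      have h2 : (2 * z : ℤ) = 2 * (N + n) + 1 := by
        have : (2 * z : ℝ) = 2 * (N + n) + 1 := by linarith
        exact_mod_cast this
      omega
  refine Infinite.of_injective
    (fun n : ℕ => ((⟨_, hmem n⟩ : {x : ℝ // p x}) : ConnectedComponents {x : ℝ // p x}))
    fun n k hnk => ?_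
  have h1 := congrArg hc.connectedComponentsLift hnk
  simp only [Continuous.connectedComponentsLift_apply_coe, add_sub_cancel_left, inv_inv] at h1
  have h2 : ∀ j : ℕ, ⌊(N : ℝ) + j + 1 / 2⌋ = N + j := fun j => by
    rw [Int.floor_eq_iff]; push_cast; constructor <;> linarith
  rw [h2, h2] at h1
  omega

lemma one_sub_cos_pow_le (n : ℕ) (x : ℝ) : 1 - cos x ^ n ≤ n * x ^ 2 / 2 := by
  have h := one_add_mul_le_pow (a := cos x - 1) (by linarith [neg_one_le_cos x]) n
  rw [add_sub_cancel] at h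
  have := mul_le_mul_of_nonneg_left (one_sub_sq_div_two_le_cos (x := x)) (Nat.cast_nonneg (α := ℝ) n)
  linarith

lemma hasDerivAt_cos_pow_succ (k : ℕ) (x : ℝ) :
    HasDerivAt (fun x => cos x ^ (k + 1)) (-((k + 1) * (cos x ^ k * sin x))) x :=
  ((hasDerivAt_cos x).pow (k + 1)).congr_deriv (by push_cast; simp; ring)

lemma hasDerivAt_deriv_cos_pow_succ (k : ℕ) (x : ℝ) :
    HasDerivAt (fun x => -((k + 1) * (cos x ^ k * sin x)))
      (-((k + 1) * (cos x ^ (k + 1) - k * cos x ^ (k - 1) * sin x ^ 2))) x :=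
  ((((hasDerivAt_cos x).pow k).mul (hasDerivAt_sin x)).const_mul ((k : ℝ) + 1)).neg.congr_deriv
    (by simp only [Pi.pow_apply]; ring)

lemma abs_cos_pow_le_one (k : ℕ) (x : ℝ) : |cos x ^ k| ≤ 1 := by
  rw [abs_pow]; exact pow_le_one₀ (abs_nonneg _) (abs_cos_le_one x)

/-- A perturbation flattening `cosⁿ` at its maximum, whose second derivative is barely larger than
`n`, and which makes the function exceed its maximum exactly on some `invNonintegers d`. -/
lemma exists_flattening_perturbation (k : ℕ) {δ : ℝ} (hδ : 0 < δ) (hδ1 : δ ≤ 1) :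
    ∃ h : ℝ → ℝ, ∃ d, 0 < d ∧ ContDiff ℝ (⊤ : ℕ∞) h ∧ (∀ x, δ ≤ |x| → h x = 0) ∧
      (∀ x, |x| ≤ δ → |h x| ≤ 3 * (k + 1) * δ ∧ |deriv h x| ≤ 3 * (k + 1) * δ ∧
        |deriv (deriv h) x| ≤ (k + 1) + 5 * (k + 1) ^ 2 * δ) ∧
      d ≤ δ ∧ ∀ x, 1 < cos x ^ (k + 1) + h x ↔ x ∈ invNonintegers d := by
  obtain ⟨χ, κ, hκ, hχ, hχ01, hχ1, hχ0, hχd⟩ := exists_log_cutoff hδ hδ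
  set d := min κ δ with hd
  obtain ⟨η, hη, hη0, hηU, hηb⟩ := (isOpen_invNonintegers d).exists_contDiff_small_pos_iff
    (isBounded_invNonintegers d) hδ
  have hη1 : ∀ x, x ∉ invNonintegers d → η x = 0 := fun x hx =>
    le_antisymm (not_lt.1 fun h => hx ((hηU x).1 h)) (hη0 x)
  have hχ' := (contDiff_infty_iff_deriv.1 hχ).2
  have hη' := (contDiff_infty_iff_deriv.1 hη).2
  set g : ℝ → ℝ := fun x => 1 - cos x ^ (k + 1) with hg
  set g1 : ℝ → ℝ := fun x => (k + 1) * (cos x ^ k * sin x) with hg1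
  set g2 : ℝ → ℝ :=
    fun x => (k + 1) * (cos x ^ (k + 1) - k * cos x ^ (k - 1) * sin x ^ 2) with hg2
  have hgd : ∀ x, HasDerivAt g (g1 x) x := fun x =>
    ((hasDerivAt_cos_pow_succ k x).const_sub 1).congr_deriv (by rw [hg1]; ring)
  have hgdd : ∀ x, HasDerivAt g1 (g2 x) x := fun x => by
    simpa [hg1, hg2] using (hasDerivAt_deriv_cos_pow_succ k x).fun_neg
  have dχ : ∀ x, HasDerivAt χ (deriv χ x) x := fun x => (hχ.differentiable (by simp) x).hasDerivAt
  have ddχ : ∀ x, HasDerivAt (deriv χ) (deriv (deriv χ) x) x :=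
    fun x => (hχ'.differentiable (by simp) x).hasDerivAt
  have dη : ∀ x, HasDerivAt η (deriv η x) x := fun x => (hη.differentiable (by simp) x).hasDerivAt
  have ddη : ∀ x, HasDerivAt (deriv η) (deriv (deriv η) x) x :=
    fun x => (hη'.differentiable (by simp) x).hasDerivAt
  have e1 : deriv (fun x => χ x * g x + η x) =
      fun x => deriv χ x * g x + χ x * g1 x + deriv η x := by
    ext x; exact (((dχ x).mul (hgd x)).add (dη x)).deriv
  have e2 : deriv (fun x => deriv χ x * g x + χ x * g1 x + deriv η x) =
      fun x => deriv (deriv χ) x * g x + 2 * (deriv χ x * g1 x) + χ x * g2 x +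
        deriv (deriv η) x := by
    ext x
    exact (((((ddχ x).mul (hgd x)).add ((dχ x).mul (hgdd x))).add (ddη x)).congr_deriv
      (by ring)).deriv
  have hg0 : ∀ x, 0 ≤ g x := fun x => sub_nonneg.2 (le_of_abs_le (abs_cos_pow_le_one _ x))
  refine ⟨fun x => χ x * g x + η x, d, lt_min hκ hδ,
    (hχ.mul (contDiff_const.sub (contDiff_cos.pow _))).add hη, fun x hx => ?_, fun x hx => ?_,
    min_le_right _ _, fun x => ?_⟩
  · have : x ∉ invNonintegers d := fun h => by
      have h1 := h.1.2.trans_le (min_le_right κ δ)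
      rw [abs_of_pos h.1.1] at hx
      linarith
    simp [hχ0 x hx, hη1 x this]
  · rw [e1, e2]
    dsimp only
    have hk : (0 : ℝ) ≤ k := k.cast_nonneg
    have hx0 := abs_nonneg x
    have hgb : |g x| ≤ (k + 1) * |x| ^ 2 := by
      have := one_sub_cos_pow_le (k + 1) x
      push_cast at this
      rw [abs_of_nonneg (hg0 x), sq_abs]
      nlinarith [sq_nonneg x]
    have hg1b : |g1 x| ≤ (k + 1) * |x| := by
      rw [hg1, abs_mul, abs_mul (cos x ^ k), abs_of_pos (by positivity : (0 : ℝ) < k + 1)]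
      gcongr
      calc _ ≤ 1 * |x| :=
            mul_le_mul (abs_cos_pow_le_one k x) abs_sin_le_abs (abs_nonneg _) zero_le_one
        _ = |x| := one_mul _
    have hg2b : |g2 x| ≤ (k + 1) * (1 + k * |x| ^ 2) := by
      rw [hg2, abs_mul, abs_of_pos (by positivity : (0 : ℝ) < k + 1)]
      gcongr
      refine (abs_sub _ _).trans (add_le_add (abs_cos_pow_le_one _ x) ?_)
      rw [abs_mul, abs_mul, abs_of_nonneg hk, abs_pow (sin x)]
      calc _ ≤ (k : ℝ) * 1 * |x| ^ 2 := by
            have h1 := abs_cos_pow_le_one (k - 1) x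
            have h2 := pow_le_pow_left₀ (abs_nonneg _) (abs_sin_le_abs (x := x)) 2
            exact mul_le_mul (mul_le_mul_of_nonneg_left h1 hk) h2 (by positivity) (by positivity)
        _ = k * |x| ^ 2 := by ring
    have hx2 : |x| ^ 2 ≤ δ := by nlinarith
    have hχx : |χ x| ≤ 1 := by rw [abs_of_nonneg (hχ01 x).1]; exact (hχ01 x).2
    have t1 : |χ x * g x| ≤ (k + 1) * δ := by
      rw [abs_mul]
      calc _ ≤ 1 * ((k + 1) * |x| ^ 2) := by gcongr
        _ ≤ (k + 1) * δ := by rw [one_mul]; gcongr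
    have t2 : |deriv χ x * g x| ≤ (k + 1) * δ := by
      rw [abs_mul]
      calc _ ≤ |deriv χ x| * ((k + 1) * |x| ^ 2) := by gcongr
        _ = (k + 1) * (|x| * |deriv χ x|) * |x| := by ring
        _ ≤ (k + 1) * δ * 1 := by gcongr; exacts [(hχd x).1, hx.trans hδ1]
        _ = _ := mul_one _
    have t3 : |χ x * g1 x| ≤ (k + 1) * δ := by
      rw [abs_mul]
      calc _ ≤ 1 * ((k + 1) * |x|) := by gcongr
        _ ≤ (k + 1) * δ := by rw [one_mul]; gcongr
    have t4 : |deriv (deriv χ) x * g x| ≤ (k + 1) * δ := by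
      rw [abs_mul]
      calc _ ≤ |deriv (deriv χ) x| * ((k + 1) * |x| ^ 2) := by gcongr
        _ = (k + 1) * (x ^ 2 * |deriv (deriv χ) x|) := by rw [sq_abs]; ring
        _ ≤ (k + 1) * δ := by gcongr; exact (hχd x).2
    have t5 : |deriv χ x * g1 x| ≤ (k + 1) * δ := by
      rw [abs_mul]
      calc _ ≤ |deriv χ x| * ((k + 1) * |x|) := by gcongr
        _ = (k + 1) * (|x| * |deriv χ x|) := by ring
        _ ≤ (k + 1) * δ := by gcongr; exact (hχd x).1
    have t6 : |χ x * g2 x| ≤ (k + 1) * (1 + k * δ) := by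
      rw [abs_mul]
      calc _ ≤ 1 * ((k + 1) * (1 + k * |x| ^ 2)) := by gcongr
        _ ≤ _ := by rw [one_mul]; gcongr
    have hkδ : 0 ≤ k * δ := by positivity
    have hkkδ : 0 ≤ k * k * δ := by positivity
    obtain ⟨b0, b1, b2⟩ := hηb x
    rw [abs_le] at t1 t2 t3 t4 t5 t6 b0 b1 b2
    refine ⟨abs_le.2 ⟨?_, ?_⟩, abs_le.2 ⟨?_, ?_⟩, abs_le.2 ⟨?_, ?_⟩⟩ <;> linarith
  · by_cases hx : |x| ≤ κ
    · simp only [← hηU, hχ1 x hx, hg]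
      constructor <;> intro h <;> linarith
    · have hxU : x ∉ invNonintegers d := fun h => hx <| by
        rw [abs_of_pos h.1.1]
        exact h.1.2.le.trans (min_le_left _ _)
      simp only [hxU, iff_false, not_lt, hη1 x hxU, add_zero]
      have := mul_le_mul_of_nonneg_right (hχ01 x).2 (hg0 x)
      rw [hg] at this ⊢
      linarith

lemma hasDerivAt_sin_pow_succ (k : ℕ) (x : ℝ) :
    HasDerivAt (fun x => sin x ^ (k + 1)) ((k + 1) * (sin x ^ k * cos x)) x :=
  ((hasDerivAt_sin x).pow (k + 1)).congr_deriv (by push_cast; ring)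

lemma hasDerivAt_deriv_sin_pow_succ (k : ℕ) (x : ℝ) :
    HasDerivAt (fun x => (k + 1) * (sin x ^ k * cos x))
      ((k + 1) * (k * sin x ^ (k - 1) * cos x ^ 2 - sin x ^ (k + 1))) x :=
  ((((hasDerivAt_sin x).pow k).mul (hasDerivAt_cos x)).const_mul ((k : ℝ) + 1)).congr_deriv
    (by simp only [Pi.pow_apply]; ring)

/-- `sin^(k+1)` is the Legendre function solving the unperturbed equation. -/
lemma sin_pow_succ_legendre (k : ℕ) (x : ℝ) :
    sin x ^ 2 * ((k + 1) * (k * sin x ^ (k - 1) * cos x ^ 2 - sin x ^ (k + 1))) +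
      sin x * cos x * ((k + 1) * (sin x ^ k * cos x)) +
      ((k + 1) * (k + 2) * sin x ^ 2 - (k + 1) ^ 2) * sin x ^ (k + 1) = 0 := by
  rcases k with _ | k
  · simp only [Nat.cast_zero]
    linear_combination (sin x) * sin_sq_add_cos_sq x
  · simp only [Nat.cast_add, Nat.cast_one, Nat.add_sub_cancel]
    linear_combination ((k : ℝ) + 2) ^ 2 * sin x ^ (k + 2) * sin_sq_add_cos_sq x

/-- If `T = sin^(k+1) + h(· - π/2)`, this is the left-hand side of the unperturbed equation. -/
noncomputable def legendreDefect (k : ℕ) (h : ℝ → ℝ) (θ : ℝ) : ℝ :=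
  sin θ ^ 2 * deriv (deriv h) (θ - π / 2) + sin θ * cos θ * deriv h (θ - π / 2) +
    ((k + 1) * (k + 2) * sin θ ^ 2 - (k + 1) ^ 2) * h (θ - π / 2)

lemma contDiff_legendreDefect (k : ℕ) {h : ℝ → ℝ} (hh : ContDiff ℝ (⊤ : ℕ∞) h) :
    ContDiff ℝ (⊤ : ℕ∞) (legendreDefect k h) := by
  have h1 := (contDiff_infty_iff_deriv.1 hh).2
  have h2 := (contDiff_infty_iff_deriv.1 h1).2
  have hs : ContDiff ℝ (⊤ : ℕ∞) sin := contDiff_sin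
  have hc : ContDiff ℝ (⊤ : ℕ∞) cos := contDiff_cos
  unfold legendreDefect
  fun_prop

/-- The linear ODE for `sin^(k+1) + h(· - π/2)` reduces to that for `h`. -/
lemma legendre_sin_pow_add (k : ℕ) {h : ℝ → ℝ} (hh : ContDiff ℝ (⊤ : ℕ∞) h) (θ : ℝ) :
    sin θ ^ 2 * deriv (deriv fun θ => sin θ ^ (k + 1) + h (θ - π / 2)) θ +
      sin θ * cos θ * deriv (fun θ => sin θ ^ (k + 1) + h (θ - π / 2)) θ +
      ((k + 1) * (k + 2) * sin θ ^ 2 - (k + 1) ^ 2) * (sin θ ^ (k + 1) + h (θ - π / 2)) =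
      legendreDefect k h θ := by
  have h1 := (contDiff_infty_iff_deriv.1 hh).2
  have e1 : deriv (fun θ => sin θ ^ (k + 1) + h (θ - π / 2)) =
      fun θ => (k + 1) * (sin θ ^ k * cos θ) + deriv h (θ - π / 2) := by
    ext x
    exact ((hasDerivAt_sin_pow_succ k x).add
      ((hh.differentiable (by simp) _).hasDerivAt.comp_sub_const x (π / 2))).deriv
  have e2 : deriv (fun θ => (k + 1) * (sin θ ^ k * cos θ) + deriv h (θ - π / 2)) θ =
      (k + 1) * (k * sin θ ^ (k - 1) * cos θ ^ 2 - sin θ ^ (k + 1)) +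
        deriv (deriv h) (θ - π / 2) :=
    ((hasDerivAt_deriv_sin_pow_succ k θ).add
      ((h1.differentiable (by simp) _).hasDerivAt.comp_sub_const θ (π / 2))).deriv
  rw [e1, e2, legendreDefect]
  linear_combination sin_pow_succ_legendre k θ

lemma legendreDefect_eventuallyEq_zero (k : ℕ) {h : ℝ → ℝ} {δ : ℝ}
    (h0 : ∀ x, δ ≤ |x| → h x = 0) {θ : ℝ} (hθ : δ < |θ - π / 2|) :
    legendreDefect k h =ᶠ[nhds θ] 0 := by
  have hev : ∀ᶠ y in nhds θ, δ < |y - π / 2| :=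
    ContinuousAt.eventually_lt continuousAt_const (by fun_prop) hθ
  filter_upwards [hev] with y hy
  have hz : h =ᶠ[nhds (y - π / 2)] fun _ => 0 := by
    have : ∀ᶠ z in nhds (y - π / 2), δ < |z| :=
      ContinuousAt.eventually_lt continuousAt_const (by fun_prop) hy
    filter_upwards [this] with z hz using h0 z hz.le
  have hz1 : deriv h =ᶠ[nhds (y - π / 2)] fun _ => 0 := by simpa using hz.deriv
  simp [legendreDefect, hz1.deriv_eq, hz1.eq_of_nhds, hz.eq_of_nhds]

/-- Near the equator, `sin² θ · T` is close to `1`. -/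
lemma sin_sq_mul_lower_bound (k : ℕ) {δ y θ : ℝ} (hδ1 : 100 * (k + 1) ^ 3 * δ = 1) (hδ : 0 < δ)
    (hθ : |θ - π / 2| ≤ δ) (hy : |y| ≤ 3 * (k + 1) * δ) :
    9 / 10 ≤ sin θ ^ 2 * (sin θ ^ (k + 1) + y) := by
  have hk : (0 : ℝ) ≤ k := k.cast_nonneg
  have hs : cos (θ - π / 2) = sin θ := cos_sub_pi_div_two θ
  have hkδ : 100 * ((k : ℝ) + 1) * δ ≤ 1 := by
    have : (k : ℝ) + 1 ≤ (k + 1) ^ 3 := le_self_pow₀ (by linarith) (by norm_num)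
    calc 100 * ((k : ℝ) + 1) * δ ≤ 100 * (k + 1) ^ 3 * δ := by gcongr
      _ = 1 := hδ1
  have hδ2 : 100 * δ ≤ 1 := by nlinarith
  have hx : (θ - π / 2) ^ 2 ≤ δ ^ 2 := sq_le_sq.2 (by rwa [abs_of_pos hδ])
  have h1 := one_sub_cos_pow_le (k + 1) (θ - π / 2)
  have h2 := one_sub_cos_pow_le 2 (θ - π / 2)
  rw [hs] at h1 h2
  push_cast at h1 h2
  have h3 : ((k : ℝ) + 1) * (θ - π / 2) ^ 2 ≤ (k + 1) * δ := by
    gcongr; nlinarith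
  have h4 : (95 : ℝ) / 100 ≤ sin θ ^ (k + 1) + y := by linarith [neg_le_of_abs_le hy]
  have h5 : (99 : ℝ) / 100 ≤ sin θ ^ 2 := by nlinarith
  nlinarith

lemma abs_legendreDefect_le (k : ℕ) {h : ℝ → ℝ} {δ θ : ℝ} (hδ1 : 100 * (k + 1) ^ 3 * δ = 1)
    (hδ : 0 < δ) (h0 : |h (θ - π / 2)| ≤ 3 * (k + 1) * δ)
    (h1 : |deriv h (θ - π / 2)| ≤ 3 * (k + 1) * δ)
    (h2 : |deriv (deriv h) (θ - π / 2)| ≤ (k + 1) + 5 * (k + 1) ^ 2 * δ) :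
    |legendreDefect k h θ| ≤ 9 / 5 * (k + 2) := by
  have hk : (0 : ℝ) ≤ k := k.cast_nonneg
  have hs : sin θ ^ 2 ≤ 1 := sin_sq_le_one θ
  have b2 : |sin θ ^ 2| ≤ 1 := by rwa [abs_of_nonneg (sq_nonneg _)]
  have b1 : |sin θ * cos θ| ≤ 1 := by
    rw [abs_mul]; exact mul_le_one₀ (abs_sin_le_one θ) (abs_nonneg _) (abs_cos_le_one θ)
  have b0 : |((k : ℝ) + 1) * (k + 2) * sin θ ^ 2 - (k + 1) ^ 2| ≤ 2 * ((k : ℝ) + 1) ^ 2 := by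
    have : ((k : ℝ) + 1) * (k + 2) * sin θ ^ 2 ≤ (k + 1) * (k + 2) * 1 := by gcongr
    have : 0 ≤ ((k : ℝ) + 1) * (k + 2) * sin θ ^ 2 := by positivity
    rw [abs_le]; constructor <;> nlinarith
  have t2 := mul_le_mul b2 h2 (abs_nonneg _) zero_le_one
  have t1 := mul_le_mul b1 h1 (abs_nonneg _) zero_le_one
  have t0 := mul_le_mul b0 h0 (abs_nonneg _) (by positivity)
  rw [← abs_mul] at t0 t1 t2
  have p1 : ((k : ℝ) + 1) * δ ≤ (k + 1) ^ 3 * δ := by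
    gcongr; exact le_self_pow₀ (by linarith) (by norm_num)
  have p2 : ((k : ℝ) + 1) ^ 2 * δ ≤ (k + 1) ^ 3 * δ := by
    gcongr <;> linarith
  refine ((abs_add_le _ _).trans (add_le_add (abs_add_le _ _) le_rfl)).trans ?_
  linarith

/-- There is `M > 0` such that for every `m ≥ M` there are `C^∞`
functions `T, Q : ℝ → ℝ` with `T(θ) = sin^m θ` and `Q ≡ 1` outside
`(π/2 − 1/m, π/2 + 1/m)`, `1 − 2/m ≤ Q ≤ 1 + 2/m`, satisfying on `(0,π)` the ODE
`sin²θ·T'' + sinθcosθ·T' + (m(m+1)Q sin²θ − m²)T = 0`, and such that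
`{θ ∈ (0,π) | T(θ) > 1}` has infinitely many connected components. (Then
`Φ_m(θ,φ) = T(θ)cos(mφ)` is an eigenfunction, with eigenvalue `m(m+1)`, of the
Laplace–Beltrami operator of `Q·g₀` on `S²`, whose super-level set `{Φ_m > 1}` has
infinitely many connected components.) -/
theorem sphere_eigenfunction_superlevel_infinitely_many_components :
    ∃ M : ℕ, 0 < M ∧ ∀ m : ℕ, M ≤ m →
    ∃ T Q : ℝ → ℝ, ContDiff ℝ (⊤ : ℕ∞) T ∧ ContDiff ℝ (⊤ : ℕ∞) Q ∧
      (∀ θ : ℝ, θ ∉ Set.Ioo (π / 2 - 1 / (m : ℝ)) (π / 2 + 1 / (m : ℝ)) →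
        T θ = Real.sin θ ^ m ∧ Q θ = 1) ∧
      (∀ θ : ℝ, 1 - 2 / (m : ℝ) ≤ Q θ ∧ Q θ ≤ 1 + 2 / (m : ℝ)) ∧
      (∀ θ ∈ Set.Ioo (0 : ℝ) π,
        Real.sin θ ^ 2 * deriv (deriv T) θ + Real.sin θ * Real.cos θ * deriv T θ +
          ((m : ℝ) * ((m : ℝ) + 1) * Q θ * Real.sin θ ^ 2 - (m : ℝ) ^ 2) * T θ = 0) ∧
      Infinite (ConnectedComponents {θ : ℝ // θ ∈ Set.Ioo (0 : ℝ) π ∧ 1 < T θ}) := by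
  refine ⟨1, one_pos, fun m hm => ?_⟩
  obtain ⟨k, rfl⟩ := Nat.exists_eq_add_of_le' hm
  have hk : (0 : ℝ) ≤ k := k.cast_nonneg
  have hk1 : (0 : ℝ) < k + 1 := by positivity
  set δ : ℝ := 1 / (100 * (k + 1) ^ 3) with hδdef
  have hδ : 0 < δ := by positivity
  have hδk : 100 * (k + 1) ^ 3 * δ = 1 := by rw [hδdef]; field_simp
  have hkk : (k : ℝ) + 1 ≤ (k + 1) ^ 3 := le_self_pow₀ (by linarith) (by norm_num)
  have hδm : δ < 1 / (k + 1) := by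
    rw [hδdef]; exact one_div_lt_one_div_of_lt hk1 (by linarith)
  have hδ1 : δ ≤ 1 := hδm.le.trans (by rw [div_le_one hk1]; linarith)
  obtain ⟨h, d, hd, hh, h0, hb, hdδ, hU⟩ := exists_flattening_perturbation k hδ hδ1
  set T : ℝ → ℝ := fun θ => sin θ ^ (k + 1) + h (θ - π / 2) with hT
  have hTs : ContDiff ℝ (⊤ : ℕ∞) T :=
    (contDiff_sin.pow _).add (hh.comp (contDiff_id.sub contDiff_const))
  set D : ℝ → ℝ := fun θ => (k + 1) * (k + 2) * (sin θ ^ 2 * T θ) with hD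
  have hDs : ContDiff ℝ (⊤ : ℕ∞) D := contDiff_const.mul ((contDiff_sin.pow 2).mul hTs)
  set Q : ℝ → ℝ := fun θ => 1 - legendreDefect k h θ / D θ with hQ
  have hnear : ∀ θ, |θ - π / 2| ≤ δ → 9 / 10 ≤ sin θ ^ 2 * T θ := fun θ hθ =>
    sin_sq_mul_lower_bound k hδk hδ hθ (hb _ hθ).1
  have hDpos : ∀ θ, |θ - π / 2| ≤ δ → 0 < D θ := fun θ hθ =>
    mul_pos (by positivity) (by linarith [hnear θ hθ])
  have hfar : ∀ θ, δ < |θ - π / 2| → Q =ᶠ[nhds θ] fun _ => 1 := fun θ hθ => by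
    filter_upwards [legendreDefect_eventuallyEq_zero k h0 hθ] with y hy
    simp [hQ, hy]
  refine ⟨T, Q, hTs, ?_, fun θ hθ => ?_, fun θ => ?_, fun θ hθ => ?_, ?_⟩
  · refine contDiff_iff_contDiffAt.2 fun θ => ?_
    rcases le_or_gt |θ - π / 2| δ with hθ | hθ
    · exact contDiffAt_const.sub
        ((contDiff_legendreDefect k hh).contDiffAt.div hDs.contDiffAt (hDpos θ hθ).ne')
    · exact contDiffAt_const.congr_of_eventuallyEq (hfar θ hθ)
  · have h1 : δ < |θ - π / 2| := by
      by_contra hc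
      have := abs_le.1 (not_lt.1 hc)
      push_cast at hθ
      exact hθ ⟨by linarith, by linarith⟩
    exact ⟨by simp [hT, h0 _ h1.le], (hfar θ h1).eq_of_nhds⟩
  · push_cast
    suffices |legendreDefect k h θ / D θ| ≤ 2 / (k + 1) by
      rw [abs_le] at this
      constructor <;> simp only [hQ] <;> linarith
    rcases le_or_gt |θ - π / 2| δ with hθ | hθ
    · obtain ⟨b0, b1, b2⟩ := hb _ hθ
      rw [abs_div, abs_of_pos (hDpos θ hθ), div_le_div_iff₀ (hDpos θ hθ) hk1]
      calc _ ≤ 9 / 5 * (k + 2) * ((k : ℝ) + 1) := by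
            gcongr; exact abs_legendreDefect_le k hδk hδ b0 b1 b2
        _ = 2 * ((k + 1) * (k + 2) * (9 / 10)) := by ring
        _ ≤ 2 * D θ := by
            simp only [hD]; gcongr; exact hnear θ hθ
    · rw [(legendreDefect_eventuallyEq_zero k h0 hθ).eq_of_nhds]
      simp only [Pi.zero_apply, zero_div, abs_zero]
      positivity
  · have hode := legendre_sin_pow_add k hh θ
    rw [← hT] at hode
    have hQD : D θ * Q θ = D θ - legendreDefect k h θ := by
      rcases le_or_gt |θ - π / 2| δ with hθ' | hθ'
      · have := (hDpos θ hθ').ne'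
        simp only [hQ]; field_simp
      · rw [(hfar θ hθ').eq_of_nhds, (legendreDefect_eventuallyEq_zero k h0 hθ').eq_of_nhds]
        simp
    simp only [hD] at hQD
    push_cast
    linear_combination hode + hQD
  · refine infinite_connectedComponents_of_iff (a := π / 2) hd fun θ => ?_
    rw [← hU, cos_sub_pi_div_two]
    refine ⟨fun h => h.2, fun h1 => ⟨?_, h1⟩⟩
    rw [← cos_sub_pi_div_two θ, hU] at h1
    have := h1.1.1
    have := h1.1.2
    constructor <;> linarith [pi_gt_three]
end
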